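/- arXiv:1606.07891 — 2 statements merged into one kernel-verified Lean document; each statement's English description precedes it below -/
import Mathlib

section
/- Let n ≥ 1, d ≥ 1 and α ∈ (0,1]. There is a constant C (one may take C = 2) such that: for every H : ℝ^d → ℝ with finite Hölder seminorm [H]_{C^α} = sup_{y≠z} |H(y) − H(z)| / |y − z|^α, and every locally integrable u : ℝ^n → ℝ^d with finite BMO seminorm, the composition H∘u satisfies [H∘u]_{BMO(ℝ^n)} ≤ C [H]_{C^α} ([u]_{BMO(ℝ^n)})^α. -/
open MeasureTheory Metric ENNReal

noncomputable section

/-- The set of upper bounds for the BMO seminorm of `f`: nonnegative `M` such that on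
every ball the mean oscillation of `f` is at most `M`. -/
def BMOBounds {n : ℕ} {E : Type*} [NormedAddCommGroup E] [NormedSpace ℝ E]
    (f : EuclideanSpace ℝ (Fin n) → E) : Set ℝ :=
  {M : ℝ | 0 ≤ M ∧ ∀ (c : EuclideanSpace ℝ (Fin n)) (r : ℝ), 0 < r →
    ⨍ x in ball c r, ‖f x - ⨍ y in ball c r, f y‖ ≤ M}

/-- The BMO seminorm `[f]_{BMO} = sup_B ⨍_B |f - f_B|`, realized as the infimum of all
upper bounds for the mean oscillation over balls. -/
def bmoSeminorm {n : ℕ} {E : Type*} [NormedAddCommGroup E] [NormedSpace ℝ E]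
    (f : EuclideanSpace ℝ (Fin n) → E) : ℝ :=
  sInf (BMOBounds f)

/-- The set of Hölder constants of exponent `α` for `H`. -/
def HolderBounds {d : ℕ} (α : ℝ) (H : EuclideanSpace ℝ (Fin d) → ℝ) : Set ℝ :=
  {L : ℝ | 0 ≤ L ∧ ∀ y z, |H y - H z| ≤ L * ‖y - z‖ ^ α}

/-- The Hölder seminorm `[H]_{C^α} = sup_{y ≠ z} |H y - H z| / |y - z|^α`, realized as the
infimum of all Hölder constants. -/
def holderSeminorm {d : ℕ} (α : ℝ) (H : EuclideanSpace ℝ (Fin d) → ℝ) : ℝ :=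
  sInf (HolderBounds α H)

/-- The infimum of the `BMOBounds` is itself such a bound. -/
theorem bmoSeminorm_mem {n : ℕ} {E : Type*} [NormedAddCommGroup E] [NormedSpace ℝ E]
    {f : EuclideanSpace ℝ (Fin n) → E} (hf : (BMOBounds f).Nonempty) :
    bmoSeminorm f ∈ BMOBounds f :=
  ⟨le_csInf hf fun _ hM => hM.1, fun c r hr => le_csInf hf fun _ hM => hM.2 c r hr⟩

theorem bmoSeminorm_le {n : ℕ} {E : Type*} [NormedAddCommGroup E] [NormedSpace ℝ E]
    {f : EuclideanSpace ℝ (Fin n) → E} {M : ℝ} (hM : M ∈ BMOBounds f) : bmoSeminorm f ≤ M :=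
  csInf_le ⟨0, fun _ h => h.1⟩ hM

/-- The infimum of the Hölder constants is itself a Hölder constant. -/
theorem holderSeminorm_mem {d : ℕ} {α : ℝ} {H : EuclideanSpace ℝ (Fin d) → ℝ}
    (hH : (HolderBounds α H).Nonempty) : holderSeminorm α H ∈ HolderBounds α H := by
  refine ⟨le_csInf hH fun _ hL => hL.1, fun y z => ?_⟩
  rcases eq_or_lt_of_le (Real.rpow_nonneg (norm_nonneg (y - z)) α) with h | h
  · obtain ⟨L, hL⟩ := hH
    simpa [← h] using hL.2 y z
  · rw [← div_le_iff₀ h]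
    exact le_csInf hH fun L hL => (div_le_iff₀ h).2 (hL.2 y z)

theorem continuous_of_mem_holderBounds {d : ℕ} {α L : ℝ} (hα : 0 < α)
    {H : EuclideanSpace ℝ (Fin d) → ℝ} (hL : L ∈ HolderBounds α H) : Continuous H := by
  refine continuous_iff_continuousAt.2 fun z => tendsto_iff_norm_sub_tendsto_zero.2 ?_
  refine squeeze_zero (fun _ => norm_nonneg _) (fun y => hL.2 y z) ?_
  have h : Continuous fun y => L * ‖y - z‖ ^ α :=
    continuous_const.mul ((continuous_id.sub continuous_const).norm.rpow_const
      fun _ => Or.inr hα.le)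
  simpa [Real.zero_rpow hα.ne'] using h.tendsto z

section ProbabilityMeasure

variable {Ω : Type*} [MeasurableSpace Ω] {μ : Measure Ω} [IsProbabilityMeasure μ]

theorem integrable_rpow_of_le_one {g : Ω → ℝ} {α : ℝ} (hα : 0 ≤ α) (hα1 : α ≤ 1)
    (hg : Integrable g μ) (hg0 : ∀ x, 0 ≤ g x) : Integrable (fun x => g x ^ α) μ := by
  refine ((integrable_const (1 : ℝ)).add hg).mono'
    ((Real.continuous_rpow_const hα).comp_aestronglyMeasurable hg.1) (ae_of_all _ fun x => ?_)
  rw [Real.norm_of_nonneg (Real.rpow_nonneg (hg0 x) α), Pi.add_apply]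
  rcases le_total (g x) 1 with h | h
  · linarith [Real.rpow_le_one (hg0 x) h hα, hg0 x]
  · linarith [Real.rpow_le_self_of_one_le h hα1]

/-- Jensen's inequality for the concave function `t ↦ t ^ α`. -/
theorem integral_rpow_le_rpow_integral {g : Ω → ℝ} {α : ℝ} (hα : 0 ≤ α) (hα1 : α ≤ 1)
    (hg : Integrable g μ) (hg0 : ∀ x, 0 ≤ g x) : ∫ x, g x ^ α ∂μ ≤ (∫ x, g x ∂μ) ^ α :=
  (Real.concaveOn_rpow hα hα1).le_map_integral (Real.continuous_rpow_const hα).continuousOn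
    isClosed_Ici (ae_of_all _ hg0) hg (integrable_rpow_of_le_one hα hα1 hg hg0)

/-- The mean oscillation is at most twice the mean deviation from any constant. -/
theorem integral_norm_sub_integral_le {f : Ω → ℝ} (hf : Integrable f μ) (b : ℝ) :
    ∫ x, ‖f x - ∫ y, f y ∂μ‖ ∂μ ≤ 2 * ∫ x, ‖f x - b‖ ∂μ := by
  have hfb : Integrable (fun x => f x - b) μ := hf.sub (integrable_const b)
  have hmean : ‖(∫ y, f y ∂μ) - b‖ ≤ ∫ x, ‖f x - b‖ ∂μ := by
    simpa [integral_sub hf (integrable_const b)] using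
      norm_integral_le_integral_norm (μ := μ) fun x => f x - b
  calc ∫ x, ‖f x - ∫ y, f y ∂μ‖ ∂μ
      ≤ ∫ x, (‖f x - b‖ + ‖(∫ y, f y ∂μ) - b‖) ∂μ := by
        refine integral_mono (hf.sub (integrable_const _)).norm
          (hfb.norm.add (integrable_const _)) fun x => ?_
        simpa using norm_sub_le (f x - b) ((∫ y, f y ∂μ) - b)
    _ = (∫ x, ‖f x - b‖ ∂μ) + ‖(∫ y, f y ∂μ) - b‖ := by
        rw [integral_add hfb.norm (integrable_const _)]
        simp
    _ ≤ 2 * ∫ x, ‖f x - b‖ ∂μ := by linarith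

theorem integral_norm_comp_sub_integral_le {d : ℕ} {α L : ℝ} (hα : 0 < α) (hα1 : α ≤ 1)
    {H : EuclideanSpace ℝ (Fin d) → ℝ} (hL : L ∈ HolderBounds α H)
    {u : Ω → EuclideanSpace ℝ (Fin d)} (hu : Integrable u μ) (a : EuclideanSpace ℝ (Fin d)) :
    ∫ x, ‖H (u x) - ∫ y, H (u y) ∂μ‖ ∂μ ≤ 2 * (L * (∫ x, ‖u x - a‖ ∂μ) ^ α) := by
  have hua : Integrable (fun x => ‖u x - a‖) μ := (hu.sub (integrable_const a)).norm
  have hdom : Integrable (fun x => L * ‖u x - a‖ ^ α) μ :=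
    (integrable_rpow_of_le_one hα.le hα1 hua fun _ => norm_nonneg _).const_mul L
  have hHua : Integrable (fun x => H (u x) - H a) μ :=
    hdom.mono' (((continuous_of_mem_holderBounds hα hL).comp_aestronglyMeasurable hu.1).sub
      aestronglyMeasurable_const) (ae_of_all _ fun x => hL.2 (u x) a)
  have hHu : Integrable (fun x => H (u x)) μ :=
    (hHua.add (integrable_const (H a))).congr (ae_of_all _ fun x => sub_add_cancel (H (u x)) (H a))
  refine (integral_norm_sub_integral_le hHu (H a)).trans
    (mul_le_mul_of_nonneg_left ?_ zero_le_two)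
  calc ∫ x, ‖H (u x) - H a‖ ∂μ ≤ ∫ x, L * ‖u x - a‖ ^ α ∂μ :=
        integral_mono hHua.norm hdom fun x => hL.2 (u x) a
    _ = L * ∫ x, ‖u x - a‖ ^ α ∂μ := integral_const_mul _ _
    _ ≤ L * (∫ x, ‖u x - a‖ ∂μ) ^ α :=
        mul_le_mul_of_nonneg_left
          (integral_rpow_le_rpow_integral hα.le hα1 hua fun _ => norm_nonneg _) hL.1

end ProbabilityMeasure

/-- There is a constant `C` such that for every `α`-Hölder `H` and every
locally integrable `u` of bounded mean oscillation,
`[H ∘ u]_{BMO} ≤ C [H]_{C^α} ([u]_{BMO})^α`. -/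
theorem bmo_composition_with_hoelder_function
    (n d : ℕ) (hn : 1 ≤ n) (hd : 1 ≤ d) (α : ℝ) (hα : 0 < α) (hα1 : α ≤ 1) :
    ∃ C : ℝ,
      ∀ (H : EuclideanSpace ℝ (Fin d) → ℝ)
        (u : EuclideanSpace ℝ (Fin n) → EuclideanSpace ℝ (Fin d)),
        LocallyIntegrable u volume →
        (HolderBounds α H).Nonempty →
        (BMOBounds u).Nonempty →
        bmoSeminorm (fun x => H (u x)) ≤ C * holderSeminorm α H * bmoSeminorm u ^ α := by
  refine ⟨2, fun H u hu hH hub => bmoSeminorm_le ?_⟩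
  have hL := holderSeminorm_mem hH
  have hM := bmoSeminorm_mem hub
  refine ⟨mul_nonneg (mul_nonneg zero_le_two hL.1) (Real.rpow_nonneg hM.1 α), fun c r hr => ?_⟩
  have hne : NeZero (volume.restrict (ball c r)) :=
    ⟨Measure.restrict_eq_zero.not.2 (measure_ball_pos volume c hr).ne'⟩
  have hfin : IsFiniteMeasure (volume.restrict (ball c r)) :=
    isFiniteMeasure_restrict.2 measure_ball_lt_top.ne
  have hint : IntegrableOn u (ball c r) volume :=
    (hu.integrableOn_isCompact (isCompact_closedBall c r)).mono_set ball_subset_closedBall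
  rw [mul_assoc]
  refine (integral_norm_comp_sub_integral_le hα hα1 hL hint.to_average
    (⨍ y in ball c r, u y)).trans ?_
  exact mul_le_mul_of_nonneg_left (mul_le_mul_of_nonneg_left
    (Real.rpow_le_rpow (integral_nonneg fun _ => norm_nonneg _) (hM.2 c r hr) hα.le) hL.1)
    zero_le_two
end
end

section
/- Let n ≥ 2, p ∈ (1,∞) with conjugate exponent p' = p/(p−1), and let q_1, q_2, q_3 ∈ [1,∞] satisfy 1/q_1 + 1/q_2 + 1/q_3 = 1. Then there is a constant C = C(n, p, q_1, q_2, q_3) such that for every smooth vector field F : ℝ^n → ℝ^n with div F = 0 and every g, h ∈ C_c^∞(ℝ^n), the div-curl estimate | ∫_{ℝ^n} (F · ∇g) h dx | ≤ C ‖F‖_{L^{p,q_1}(ℝ^n)} ‖∇h‖_{L^{p',q_2}(ℝ^n)} ‖∇g‖_{L^{n,q_3}(ℝ^n)} holds (the left-hand side being interpreted as +∞-free since the integrand is compactly supported). -/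
open MeasureTheory Metric ENNReal

noncomputable section

/-- The Lorentz `L^{p,q}` quasinorm of `f` on `ℝ^n` (w.r.t. the measure `μ`):
for `q < ∞`, `‖f‖_{L^{p,q}} = ( p ∫_0^∞ t^{q-1} |{x : |f x| > t}|^{q/p} dt )^{1/q}`, and for
`q = ∞`, `‖f‖_{L^{p,∞}} = sup_{t>0} t |{x : |f x| > t}|^{1/p}`. -/
def lorentzNorm {X : Type*} [MeasurableSpace X] (μ : Measure X) (p : ℝ) (q : ℝ≥0∞)
    (f : X → ℝ) : ℝ≥0∞ :=
  if q = ⊤ then ⨆ t : ℝ, ENNReal.ofReal t * (μ {x | t < |f x|}) ^ (1 / p)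
  else (ENNReal.ofReal p *
    ∫⁻ t in Set.Ioi (0 : ℝ),
      ENNReal.ofReal (t ^ (q.toReal - 1)) * (μ {x | t < |f x|}) ^ (q.toReal / p))
    ^ (1 / q.toReal)

theorem eq_zero_of_lorentzNorm_eq_zero {X : Type*} [TopologicalSpace X] [MeasurableSpace X]
    [BorelSpace X] {μ : Measure X} [μ.IsOpenPosMeasure] {p : ℝ} (hp : 0 < p) {q : ℝ≥0∞}
    (hq : 1 ≤ q) {f : X → ℝ} (hf : Continuous f) (h : lorentzNorm μ p q f = 0) (x : X) :
    f x = 0 := by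
  by_contra hx
  set s := |f x| / 2 with hs
  have hs0 : 0 < s := by positivity
  have hm : μ {y | s < |f y|} ≠ 0 := by
    refine ((isOpen_lt continuous_const hf.abs).measure_pos μ ⟨x, ?_⟩).ne'
    rw [Set.mem_ofPred_eq, hs]
    linarith [abs_pos.2 hx]
  have hmr : ∀ r : ℝ, 0 ≤ r → μ {y | s < |f y|} ^ r ≠ 0 := fun r hr h0 =>
    (ENNReal.rpow_eq_zero_iff.1 h0).elim (fun h => hm h.1) fun h => by linarith [h.2]
  rw [lorentzNorm] at h
  split_ifs at h with hqt
  · have h1 := (le_iSup (fun t : ℝ => ENNReal.ofReal t * (μ {x | t < |f x|}) ^ (1 / p)) s).trans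
      h.le
    rw [nonpos_iff_eq_zero, mul_eq_zero, ENNReal.ofReal_eq_zero] at h1
    exact h1.elim (fun h => by linarith) (hmr _ (by positivity))
  · have hq1 : 1 ≤ q.toReal := by simpa using ENNReal.toReal_mono hqt hq
    rw [ENNReal.rpow_eq_zero_iff_of_pos (by positivity), mul_eq_zero, ENNReal.ofReal_eq_zero] at h
    rcases h with h | h
    · linarith
    have hle : ∫⁻ _ in Set.Ioo (s / 2) s, ENNReal.ofReal ((s / 2) ^ (q.toReal - 1)) *
        μ {y | s < |f y|} ^ (q.toReal / p) ≤ 0 := by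
      rw [← h]
      refine (setLIntegral_mono' measurableSet_Ioo fun t ht => ?_).trans
        (lintegral_mono_set fun t ht => (half_pos hs0).trans ht.1)
      refine mul_le_mul' (ENNReal.ofReal_le_ofReal (Real.rpow_le_rpow (by positivity) ht.1.le
        (by linarith))) (ENNReal.rpow_le_rpow (measure_mono fun y hy => ht.2.trans hy)
        (by positivity))
    rw [setLIntegral_const, Real.volume_Ioo, nonpos_iff_eq_zero, mul_eq_zero, mul_eq_zero,
      ENNReal.ofReal_eq_zero, ENNReal.ofReal_eq_zero] at hle
    rcases hle with (h1 | h1) | h1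
    · exact (Real.rpow_pos_of_pos (half_pos hs0) _).not_ge h1
    · exact hmr _ (by positivity) h1
    · linarith

theorem tsum_two_rpow_neg_abs_ne_top {ε : ℝ} (hε : 0 < ε) :
    ∑' m : ℤ, (2 : ℝ≥0∞) ^ (-(ε * |(m : ℝ)|)) ≠ ⊤ := by
  have hr0 : (0 : ℝ) ≤ 2 ^ (-ε) := by positivity
  have hr1 : (2 : ℝ) ^ (-ε) < 1 := Real.rpow_lt_one_of_one_lt_of_neg (by norm_num) (by linarith)
  have hs : Summable fun k : ℕ => ((2 : ℝ) ^ (-ε)) ^ k := summable_geometric_of_lt_one hr0 hr1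
  have hk : ∀ k : ℕ, (2 : ℝ) ^ (-(ε * (k : ℝ))) = ((2 : ℝ) ^ (-ε)) ^ k := fun k => by
    rw [← Real.rpow_natCast, ← Real.rpow_mul (by norm_num)]; ring_nf
  have h : Summable fun m : ℤ => (2 : ℝ) ^ (-(ε * |(m : ℝ)|)) := by
    apply Summable.of_nat_of_neg
    · simpa [hk] using hs
    · simpa [hk] using hs
  have h2 : ∀ m : ℤ, (2 : ℝ≥0∞) ^ (-(ε * |(m : ℝ)|))
      = ENNReal.ofReal ((2 : ℝ) ^ (-(ε * |(m : ℝ)|))) := fun m => by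
    rw [← ENNReal.ofReal_rpow_of_pos (by norm_num)]; norm_num
  simp_rw [h2]
  exact h.tsum_ofReal_ne_top

theorem tsum_two_rpow_neg_abs_sub (ε : ℝ) (i : ℤ) :
    ∑' j : ℤ, (2 : ℝ≥0∞) ^ (-(ε * |(i : ℝ) - j|))
      = ∑' m : ℤ, (2 : ℝ≥0∞) ^ (-(ε * |(m : ℝ)|)) := by
  rw [← (Equiv.subLeft i).tsum_eq]
  simp

theorem tsum_two_rpow_neg_abs_sub' (ε : ℝ) (i : ℤ) :
    ∑' j : ℤ, (2 : ℝ≥0∞) ^ (-(ε * |(j : ℝ) - i|))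
      = ∑' m : ℤ, (2 : ℝ≥0∞) ^ (-(ε * |(m : ℝ)|)) := by
  rw [← tsum_two_rpow_neg_abs_sub ε i]
  simp_rw [abs_sub_comm]

theorem tsum_two_rpow_lt_le {α : ℝ} (hα : 0 < α) (L : ℝ≥0∞) :
    ∑' j : ℤ, (if (2 : ℝ≥0∞) ^ (j : ℝ) < L then (2 : ℝ≥0∞) ^ (j * α) else 0)
      ≤ (∑' m : ℤ, (2 : ℝ≥0∞) ^ (-(α * |(m : ℝ)|))) * L ^ α := by
  rcases eq_or_ne L 0 with rfl | hL0
  · simp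
  rcases eq_or_ne L ⊤ with rfl | hLt
  · rw [ENNReal.top_rpow_of_pos hα, ENNReal.mul_top]
    · exact le_top
    · intro h
      have := ENNReal.tsum_eq_zero.1 h 0
      simp at this
  have hpos : 0 < L.toReal := ENNReal.toReal_pos hL0 hLt
  have hL : L = (2 : ℝ≥0∞) ^ (Real.logb 2 L.toReal) := by
    have h2 : (2 : ℝ≥0∞) = ENNReal.ofReal 2 := by norm_num
    rw [h2, ENNReal.ofReal_rpow_of_pos (by norm_num),
      Real.rpow_logb (by norm_num) (by norm_num) hpos,
      ENNReal.ofReal_toReal hLt]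
  set l := Real.logb 2 L.toReal
  rw [← tsum_two_rpow_neg_abs_sub α ⌊l⌋, ← ENNReal.tsum_mul_right]
  refine ENNReal.tsum_le_tsum fun j => ?_
  split_ifs with h
  · rw [hL] at h ⊢
    have hj : (j : ℝ) < l := by
      by_contra hc
      exact absurd h (not_lt.2 (ENNReal.rpow_le_rpow_of_exponent_le (by norm_num) (not_lt.1 hc)))
    have hj' : (j : ℝ) ≤ ⌊l⌋ := by exact_mod_cast Int.le_floor.2 hj.le
    rw [← ENNReal.rpow_mul, ← ENNReal.rpow_add _ _ (by norm_num) (by norm_num)]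
    apply ENNReal.rpow_le_rpow_of_exponent_le (by norm_num)
    rw [abs_of_nonneg (by linarith)]
    nlinarith [Int.floor_le l]
  · exact zero_le

section Decomposition

variable {X : Type*} [MeasurableSpace X]

/-- The decreasing rearrangement of `|f|` at the point `2 ^ j`. -/
def dyadicHeight (μ : Measure X) (f : X → ℝ) (j : ℤ) : ℝ≥0∞ :=
  ⨆ (t : ℝ) (_ : (2 : ℝ≥0∞) ^ (j : ℝ) < μ {x | t < |f x|}), ENNReal.ofReal t

theorem dyadicHeight_antitone (μ : Measure X) (f : X → ℝ) : Antitone (dyadicHeight μ f) := by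
  intro i j hij
  refine iSup₂_le fun t ht => le_iSup₂_of_le t (lt_of_le_of_lt ?_ ht) le_rfl
  exact ENNReal.rpow_le_rpow_of_exponent_le (by norm_num) (by exact_mod_cast hij)

theorem measure_dyadicHeight_lt_le (μ : Measure X) (f : X → ℝ) (j : ℤ) :
    μ {x | dyadicHeight μ f j < ENNReal.ofReal |f x|} ≤ (2 : ℝ≥0∞) ^ (j : ℝ) := by
  rcases eq_or_ne (dyadicHeight μ f j) ⊤ with h | h
  · simp [h]
  set R := (dyadicHeight μ f j).toReal with hR
  have hRe : dyadicHeight μ f j = ENNReal.ofReal R := (ENNReal.ofReal_toReal h).symm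
  have hset : {x | dyadicHeight μ f j < ENNReal.ofReal |f x|}
      = ⋃ k : ℕ, {x | R + 1 / ((k : ℝ) + 1) < |f x|} := by
    ext x
    simp only [Set.mem_ofPred_eq, Set.mem_iUnion]
    rw [hRe, ENNReal.ofReal_lt_ofReal_iff_of_nonneg ENNReal.toReal_nonneg]
    constructor
    · intro hx
      obtain ⟨k, hk⟩ := exists_nat_one_div_lt (sub_pos.2 hx)
      exact ⟨k, by linarith⟩
    · rintro ⟨k, hk⟩
      have : (0 : ℝ) < 1 / ((k : ℝ) + 1) := by positivity
      linarith
  have hmono : Monotone fun k : ℕ => {x | R + 1 / ((k : ℝ) + 1) < |f x|} := by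
    intro k l hkl x hx
    simp only [Set.mem_ofPred_eq] at hx ⊢
    have : (1 : ℝ) / (l + 1) ≤ 1 / (k + 1) := by gcongr
    linarith
  rw [hset, hmono.measure_iUnion]
  refine iSup_le fun k => ?_
  by_contra hc
  have h1 : ENNReal.ofReal (R + 1 / ((k : ℝ) + 1)) ≤ dyadicHeight μ f j :=
    le_iSup₂_of_le (R + 1 / ((k : ℝ) + 1)) (not_le.1 hc) le_rfl
  rw [hRe, ENNReal.ofReal_le_ofReal_iff ENNReal.toReal_nonneg] at h1
  have : (0 : ℝ) < 1 / ((k : ℝ) + 1) := by positivity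
  linarith

theorem dyadicHeight_rpow_le (μ : Measure X) (f : X → ℝ) (j : ℤ) {q : ℝ} (hq : 1 ≤ q) :
    dyadicHeight μ f j ^ q ≤ ENNReal.ofReal q * ∫⁻ t in Set.Ioi (0 : ℝ),
      (if (2 : ℝ≥0∞) ^ (j : ℝ) < μ {x | t < |f x|} then ENNReal.ofReal (t ^ (q - 1)) else 0) := by
  have hq0 : 0 < q := by linarith
  rw [← ENNReal.le_rpow_inv_iff hq0]
  refine iSup₂_le fun s hs => ?_
  rw [ENNReal.le_rpow_inv_iff hq0]
  rcases le_or_gt s 0 with h0 | h0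
  · simp [ENNReal.ofReal_of_nonpos h0, hq0]
  have h_int : IntervalIntegrable (fun t : ℝ => t ^ (q - 1)) volume 0 s :=
    intervalIntegral.intervalIntegrable_rpow' (by linarith)
  have h1 : ENNReal.ofReal s ^ q
      = ENNReal.ofReal q * ∫⁻ t in Set.Ioc (0 : ℝ) s, ENNReal.ofReal (t ^ (q - 1)) := by
    rw [← ofReal_integral_eq_lintegral_ofReal, ← intervalIntegral.integral_of_le h0.le,
      integral_rpow (Or.inl (by linarith)), ← ENNReal.ofReal_mul hq0.le,
      ENNReal.ofReal_rpow_of_pos h0]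
    · congr 1
      simp only [sub_add_cancel]
      rw [Real.zero_rpow hq0.ne']
      field_simp
      simp
    · exact (intervalIntegrable_iff_integrableOn_Ioc_of_le h0.le).1 h_int
    · filter_upwards [ae_restrict_mem measurableSet_Ioc] with t ht
      exact Real.rpow_nonneg ht.1.le _
  rw [h1]
  refine mul_le_mul' le_rfl ?_
  calc ∫⁻ t in Set.Ioc (0 : ℝ) s, ENNReal.ofReal (t ^ (q - 1)) = ∫⁻ t in Set.Ioc (0 : ℝ) s,
        (if (2 : ℝ≥0∞) ^ (j : ℝ) < μ {x | t < |f x|} then ENNReal.ofReal (t ^ (q - 1)) else 0) := by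
        refine setLIntegral_congr_fun measurableSet_Ioc fun t ht => ?_
        rw [if_pos]
        exact lt_of_lt_of_le hs (measure_mono fun x hx => lt_of_le_of_lt ht.2 hx)
    _ ≤ _ := lintegral_mono_set Set.Ioc_subset_Ioi_self

theorem measurable_distribution (μ : Measure X) (f : X → ℝ) :
    Measurable fun t : ℝ => μ {x | t < |f x|} := by
  apply Antitone.measurable
  intro s t hst
  exact measure_mono fun x hx => lt_of_le_of_lt hst hx

theorem tsum_dyadicHeight_rpow_le (μ : Measure X) (f : X → ℝ) {p q : ℝ} (hp : 0 < p)
    (hq : 1 ≤ q) :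
    ∑' j : ℤ, ((2 : ℝ≥0∞) ^ (j / p) * dyadicHeight μ f j) ^ q
      ≤ (ENNReal.ofReal q * ∑' m : ℤ, (2 : ℝ≥0∞) ^ (-(q / p * |(m : ℝ)|))) *
        ∫⁻ t in Set.Ioi (0 : ℝ),
          ENNReal.ofReal (t ^ (q - 1)) * (μ {x | t < |f x|}) ^ (q / p) := by
  have hq0 : 0 < q := by linarith
  have hα : 0 < q / p := by positivity
  have hm := measurable_distribution μ f
  calc _ ≤ ∑' j : ℤ, (2 : ℝ≥0∞) ^ (j * (q / p)) * (ENNReal.ofReal q * ∫⁻ t in Set.Ioi (0 : ℝ),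
      (if (2 : ℝ≥0∞) ^ (j : ℝ) < μ {x | t < |f x|} then ENNReal.ofReal (t ^ (q - 1)) else 0)) := by
        refine ENNReal.tsum_le_tsum fun j => ?_
        rw [ENNReal.mul_rpow_of_nonneg _ _ hq0.le, ← ENNReal.rpow_mul,
          show (j : ℝ) / p * q = j * (q / p) by ring]
        gcongr
        exact dyadicHeight_rpow_le μ f j hq
    _ = ENNReal.ofReal q * ∫⁻ t in Set.Ioi (0 : ℝ), ENNReal.ofReal (t ^ (q - 1)) *
          ∑' j : ℤ, (if (2 : ℝ≥0∞) ^ (j : ℝ) < μ {x | t < |f x|}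
            then (2 : ℝ≥0∞) ^ (j * (q / p)) else 0) := by
        simp_rw [← ENNReal.tsum_mul_left]
        rw [lintegral_tsum, ← ENNReal.tsum_mul_left]
        · congr 1
          ext j
          rw [mul_left_comm, ← lintegral_const_mul]
          · congr 2
            ext t
            split_ifs <;> simp [mul_comm]
          · exact Measurable.ite (measurableSet_lt measurable_const hm) (by fun_prop)
              measurable_const
        · intro j
          exact (Measurable.mul (by fun_prop) (Measurable.ite (measurableSet_lt measurable_const hm)
            measurable_const measurable_const)).aemeasurable
    _ ≤ ENNReal.ofReal q * ∫⁻ t in Set.Ioi (0 : ℝ), ENNReal.ofReal (t ^ (q - 1)) *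
          ((∑' m : ℤ, (2 : ℝ≥0∞) ^ (-(q / p * |(m : ℝ)|))) * (μ {x | t < |f x|}) ^ (q / p)) := by
        gcongr
        exact tsum_two_rpow_lt_le hα _
    _ = _ := by
        rw [mul_assoc]
        congr 1
        rw [← lintegral_const_mul]
        · simp_rw [mul_left_comm]
        · exact Measurable.mul (by fun_prop) (hm.pow_const _)

end Decomposition

section LorentzDecomposition

variable {X : Type*} [MeasurableSpace X]

theorem exists_dyadicHeight_le_lorentzNorm (μ : Measure X) {p : ℝ} (hp : 0 < p) {q : ℝ≥0∞}
    (hq : 1 ≤ q) :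
    ∃ C : ℝ≥0∞, C ≠ ⊤ ∧ ∀ f : X → ℝ, lorentzNorm μ p q f ≠ 0 → lorentzNorm μ p q f ≠ ⊤ →
      ∃ a : ℤ → ℝ≥0∞, ∑' j, a j ≤ 1 ∧
        ∀ j : ℤ, (2 : ℝ≥0∞) ^ (j / p) * dyadicHeight μ f j
          ≤ C * lorentzNorm μ p q f * a j ^ (1 / q).toReal := by
  rcases eq_or_ne q ⊤ with rfl | hqt
  · refine ⟨1, by simp, fun f _ _ => ⟨fun _ => 0, by simp, fun j => ?_⟩⟩
    simp only [dyadicHeight, lorentzNorm, if_true, ENNReal.mul_iSup]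
    simp only [one_mul, one_div, ENNReal.inv_top, ENNReal.toReal_zero, ENNReal.rpow_zero, mul_one]
    refine iSup₂_le fun t ht => le_iSup_of_le t ?_
    rw [mul_comm]
    gcongr
    rw [div_eq_mul_inv, ENNReal.rpow_mul]
    gcongr
  · have hq1 : 1 ≤ q.toReal := by
      rw [← ENNReal.toReal_one]; exact ENNReal.toReal_mono hqt hq
    have hq0 : 0 < q.toReal := by linarith
    set C₁ := ENNReal.ofReal q.toReal *
      ∑' m : ℤ, (2 : ℝ≥0∞) ^ (-(q.toReal / p * |(m : ℝ)|)) with hC₁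
    have hC₁t : C₁ ≠ ⊤ := ENNReal.mul_ne_top ENNReal.ofReal_ne_top
      (tsum_two_rpow_neg_abs_ne_top (by positivity))
    have hp' : ENNReal.ofReal p ≠ 0 := by simpa using hp
    set D := C₁ / ENNReal.ofReal p + 1 with hD
    have hDt : D ≠ ⊤ := by
      simp only [hD, ne_eq, ENNReal.add_eq_top, ENNReal.one_ne_top, or_false]
      exact ENNReal.div_ne_top hC₁t hp'
    have hD0 : D ≠ 0 := by simp [hD]
    refine ⟨D ^ (1 / q.toReal), ENNReal.rpow_ne_top_of_nonneg (by positivity) hDt,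
      fun f h0 ht => ?_⟩
    set N := lorentzNorm μ p q f with hN
    set b : ℤ → ℝ≥0∞ := fun j => ((2 : ℝ≥0∞) ^ (j / p) * dyadicHeight μ f j) ^ q.toReal with hb
    set I := ∫⁻ t in Set.Ioi (0 : ℝ),
          ENNReal.ofReal (t ^ (q.toReal - 1)) * (μ {x | t < |f x|}) ^ (q.toReal / p) with hI
    have hNI : N ^ q.toReal = ENNReal.ofReal p * I := by
      rw [hN, lorentzNorm, if_neg hqt, ← ENNReal.rpow_mul, one_div_mul_cancel hq0.ne',
        ENNReal.rpow_one]
    have hNq0 : N ^ q.toReal ≠ 0 := by simp [ENNReal.rpow_eq_zero_iff, h0, ht]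
    have hNqt : N ^ q.toReal ≠ ⊤ := ENNReal.rpow_ne_top_of_nonneg hq0.le ht
    have hsum : ∑' j, b j ≤ D * N ^ q.toReal := by
      calc ∑' j, b j ≤ C₁ * I := tsum_dyadicHeight_rpow_le μ f hp hq1
        _ = C₁ / ENNReal.ofReal p * N ^ q.toReal := by
            rw [hNI, ← mul_assoc, ENNReal.div_mul_cancel hp' ENNReal.ofReal_ne_top]
        _ ≤ _ := by gcongr; exact le_self_add
    have hM0 : D * N ^ q.toReal ≠ 0 := mul_ne_zero hD0 hNq0
    have hMt : D * N ^ q.toReal ≠ ⊤ := ENNReal.mul_ne_top hDt hNqt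
    refine ⟨fun j => b j / (D * N ^ q.toReal), ?_, fun j => le_of_eq ?_⟩
    · simp_rw [div_eq_mul_inv]
      rw [ENNReal.tsum_mul_right, ← div_eq_mul_inv]
      exact ENNReal.div_le_of_le_mul (by simpa using hsum)
    · have e1 : (1 / q).toReal = 1 / q.toReal := by simp [one_div]
      have e2 : N = (N ^ q.toReal) ^ (1 / q.toReal) := by
        rw [← ENNReal.rpow_mul, mul_one_div_cancel hq0.ne', ENNReal.rpow_one]
      rw [e1]
      nth_rewrite 1 [e2]
      rw [← ENNReal.mul_rpow_of_nonneg _ _ (by positivity),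
        ← ENNReal.mul_rpow_of_nonneg _ _ (by positivity), ENNReal.mul_div_cancel hM0 hMt, hb]
      simp only
      rw [← ENNReal.rpow_mul, mul_one_div_cancel hq0.ne', ENNReal.rpow_one]

theorem le_tsum_dyadicHeight [TopologicalSpace X] (μ : Measure X) [μ.IsOpenPosMeasure] {f : X → ℝ}
    (hf : Continuous f) {p : ℝ} (hp : 0 < p) {K : ℝ≥0∞} (hK : K ≠ ⊤)
    (h : ∀ j : ℤ, (2 : ℝ≥0∞) ^ (j / p) * dyadicHeight μ f j ≤ K) (x : X) :
    ENNReal.ofReal |f x| ≤ ∑' j : ℤ, dyadicHeight μ f (j - 1) *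
      {x | dyadicHeight μ f j < ENNReal.ofReal |f x|}.indicator 1 x := by
  set y := ENNReal.ofReal |f x| with hy
  rcases eq_or_ne y 0 with hy0 | hy0
  · simp [hy0]
  have hyt : y ≠ ⊤ := ENNReal.ofReal_ne_top
  have hind : ∀ j : ℤ, dyadicHeight μ f j < y →
      {x | dyadicHeight μ f j < ENNReal.ofReal |f x|}.indicator (1 : X → ℝ≥0∞) x = 1 :=
    fun j hj => Set.indicator_of_mem (by exact hj) _
  by_cases hex : ∃ j : ℤ, y ≤ dyadicHeight μ f j
  · obtain ⟨k, hk⟩ := ENNReal.exists_nat_gt (ENNReal.div_ne_top hK hy0)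
    have hbdd : ∀ j : ℤ, y ≤ dyadicHeight μ f j → j ≤ ⌈p * k⌉ := by
      intro j hj
      by_contra hc
      have hjk : (k : ℝ) ≤ j / p := by
        rw [le_div_iff₀ hp]
        have h1 : p * k ≤ ⌈p * k⌉ := Int.le_ceil _
        have h2 : ((⌈p * k⌉ : ℤ) : ℝ) ≤ j := by exact_mod_cast (not_le.1 hc).le
        linarith
      have h3 : (k : ℝ≥0∞) ≤ (2 : ℝ≥0∞) ^ (j / p) := by
        calc (k : ℝ≥0∞) ≤ (2 : ℝ≥0∞) ^ k := by exact_mod_cast Nat.lt_two_pow_self.le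
          _ = (2 : ℝ≥0∞) ^ (k : ℝ) := (ENNReal.rpow_natCast _ _).symm
          _ ≤ _ := ENNReal.rpow_le_rpow_of_exponent_le (by norm_num) hjk
      have h4 : (k : ℝ≥0∞) * y ≤ K := le_trans (by gcongr) (h j)
      have h5 : (k : ℝ≥0∞) ≤ K / y := by
        rwa [ENNReal.le_div_iff_mul_le (Or.inl hy0) (Or.inl hyt)]
      exact absurd hk (not_lt.2 h5)
    obtain ⟨m, hm1, hm2⟩ := Int.exists_greatest_of_bdd ⟨_, hbdd⟩ hex
    have hm3 : dyadicHeight μ f (m + 1) < y := by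
      by_contra hc
      have := hm2 _ (not_lt.1 hc)
      omega
    refine le_trans ?_ (ENNReal.le_tsum (m + 1))
    rw [hind _ hm3]
    simpa using hm1
  · push Not at hex
    obtain ⟨j₀, hj₀⟩ : ∃ j, dyadicHeight μ f j ≠ 0 := by
      by_contra hc
      push Not at hc
      have hU : μ {z | 0 < |f z|} = 0 := by
        by_contra hne
        obtain ⟨k, hk⟩ := ENNReal.exists_inv_two_pow_lt hne
        have := measure_dyadicHeight_lt_le μ f (-k)
        rw [hc] at this
        simp only [ENNReal.ofReal_pos] at this
        refine absurd (lt_of_lt_of_le hk this) ?_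
        simp [ENNReal.rpow_neg, ENNReal.inv_pow]
      have := ((isOpen_lt continuous_const hf.abs).measure_eq_zero_iff μ).1 hU
      have hx : x ∈ {z | 0 < |f z|} := by
        have := pos_iff_ne_zero.2 hy0
        rwa [hy, ENNReal.ofReal_pos] at this
      rw [this] at hx
      exact hx
    have hinj : Function.Injective fun k : ℕ => j₀ - k := fun k l hkl => by
      simpa using hkl
    calc y ≤ ⊤ := le_top
      _ = ∑' _ : ℕ, dyadicHeight μ f j₀ := (ENNReal.tsum_const_eq_top_of_ne_zero hj₀).symm
      _ ≤ ∑' k : ℕ, dyadicHeight μ f (j₀ - k - 1) *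
          {x | dyadicHeight μ f (j₀ - k) < ENNReal.ofReal |f x|}.indicator 1 x := by
        refine ENNReal.tsum_le_tsum fun k => ?_
        rw [hind _ (hex _), mul_one]
        exact dyadicHeight_antitone μ f (by omega)
      _ ≤ _ := ENNReal.tsum_comp_le_tsum_of_injective hinj fun j => dyadicHeight μ f (j - 1) *
          {x | dyadicHeight μ f j < ENNReal.ofReal |f x|}.indicator 1 x

/-- Atomic decomposition of a continuous function in a Lorentz space. -/
theorem exists_lorentz_decomposition [TopologicalSpace X] [BorelSpace X] (μ : Measure X)
    [μ.IsOpenPosMeasure] {p : ℝ} (hp : 1 ≤ p) {q : ℝ≥0∞} (hq : 1 ≤ q) :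
    ∃ C : ℝ≥0∞, C ≠ ⊤ ∧ ∀ f : X → ℝ, Continuous f →
      lorentzNorm μ p q f ≠ 0 → lorentzNorm μ p q f ≠ ⊤ →
      ∃ (r : ℤ → ℝ≥0∞) (E : ℤ → Set X) (a : ℤ → ℝ≥0∞),
        (∀ j, MeasurableSet (E j)) ∧ (∀ j : ℤ, μ (E j) ≤ (2 : ℝ≥0∞) ^ (j : ℝ)) ∧
        (∀ x, ENNReal.ofReal |f x| ≤ ∑' j, r j * (E j).indicator 1 x) ∧
        (∀ j : ℤ, r j ≤ C * lorentzNorm μ p q f * (2 : ℝ≥0∞) ^ (-(j / p)) *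
          a j ^ (1 / q).toReal) ∧ ∑' j, a j ≤ 1 := by
  have hp0 : 0 < p := by linarith
  obtain ⟨C, hC, H⟩ := exists_dyadicHeight_le_lorentzNorm μ hp0 hq
  refine ⟨2 * C, ENNReal.mul_ne_top (by norm_num) hC, fun f hf h0 ht => ?_⟩
  obtain ⟨a, ha, hra⟩ := H f h0 ht
  have ha1 : ∀ j, a j ≤ 1 := fun j => (ENNReal.le_tsum j).trans ha
  refine ⟨fun j => dyadicHeight μ f (j - 1),
    fun j => {x | dyadicHeight μ f j < ENNReal.ofReal |f x|}, fun j => a (j - 1),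
    fun j => measurableSet_lt measurable_const hf.abs.measurable.ennreal_ofReal,
    fun j => measure_dyadicHeight_lt_le μ f j,
    le_tsum_dyadicHeight μ hf hp0 (ENNReal.mul_ne_top hC ht) fun j => (hra j).trans ?_,
    fun j => ?_, ?_⟩
  · exact mul_le_of_le_one_right' (ENNReal.rpow_le_one (ha1 j) ENNReal.toReal_nonneg)
  · have h1 := hra (j - 1)
    have h2 : (2 : ℝ≥0∞) ^ (-(((j - 1 : ℤ) : ℝ) / p)) ≤ 2 * (2 : ℝ≥0∞) ^ (-(j / p)) := by
      nth_rewrite 2 [← ENNReal.rpow_one 2]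
      rw [← ENNReal.rpow_add _ _ (by norm_num) (by norm_num)]
      apply ENNReal.rpow_le_rpow_of_exponent_le (by norm_num)
      have : 1 / p ≤ 1 := by rw [div_le_one hp0]; exact hp
      push_cast
      rw [sub_div]
      linarith
    calc dyadicHeight μ f (j - 1) = (2 : ℝ≥0∞) ^ (-(((j - 1 : ℤ) : ℝ) / p)) *
          ((2 : ℝ≥0∞) ^ (((j - 1 : ℤ) : ℝ) / p) * dyadicHeight μ f (j - 1)) := by
          rw [← mul_assoc, ← ENNReal.rpow_add _ _ (by norm_num) (by norm_num)]
          simp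
      _ ≤ 2 * (2 : ℝ≥0∞) ^ (-(j / p)) *
          (C * lorentzNorm μ p q f * a (j - 1) ^ (1 / q).toReal) := by gcongr
      _ = _ := by ring
  · exact ((Equiv.subRight (1 : ℤ)).tsum_eq a).trans_le ha

end LorentzDecomposition

section DiscreteForm

theorem le_two_rpow_of_pair_bounds {α β γ κ : ℝ} (hα : 0 < α) (hβ : 0 < β) (hγ : 0 < γ)
    (hα1 : α < 1) (hβ1 : β < 1) (hγ1 : γ < 1) (hs : α + β + γ = 1 + κ) :
    ∃ ε : ℝ, 0 < ε ∧ ∀ (i j l : ℝ) (C L : ℝ≥0∞),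
      L ≤ C * (2 : ℝ≥0∞) ^ (i + κ * j) → L ≤ C * (2 : ℝ≥0∞) ^ (j + κ * i) →
      L ≤ C * (2 : ℝ≥0∞) ^ (i + κ * l) → L ≤ C * (2 : ℝ≥0∞) ^ (l + κ * i) →
      L ≤ C * (2 : ℝ≥0∞) ^ (j + κ * l) → L ≤ C * (2 : ℝ≥0∞) ^ (l + κ * j) →
      L ≤ C * (2 : ℝ≥0∞) ^ (α * i + β * j + γ * l - ε * |i - j| - ε * |i - l|) := by
  obtain ⟨ε, hε, h1, h2, h3, h4, h5, h6⟩ : ∃ ε : ℝ, 0 < ε ∧ 2 * ε ≤ α ∧ 2 * ε ≤ β ∧ 2 * ε ≤ γ ∧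
      2 * ε ≤ 1 - α ∧ 2 * ε ≤ 1 - β ∧ 2 * ε ≤ 1 - γ := by
    have hm : 0 < min (min α (min β γ)) (min (1 - α) (min (1 - β) (1 - γ))) := by
      simp only [lt_min_iff]; refine ⟨⟨hα, hβ, hγ⟩, ?_, ?_, ?_⟩ <;> linarith
    refine ⟨min (min α (min β γ)) (min (1 - α) (min (1 - β) (1 - γ))) / 2, by linarith, ?_⟩
    rw [mul_div_cancel₀ _ (by norm_num : (2 : ℝ) ≠ 0)]
    simp
  refine ⟨ε, hε, fun i j l C L b1 b2 b3 b4 b5 b6 => ?_⟩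
  have key : ∀ x : ℝ, L ≤ C * (2 : ℝ≥0∞) ^ x →
      x ≤ α * i + β * j + γ * l - ε * |i - j| - ε * |i - l| →
      L ≤ C * (2 : ℝ≥0∞) ^ (α * i + β * j + γ * l - ε * |i - j| - ε * |i - l|) := by
    intro x hx hle
    refine hx.trans ?_
    gcongr
    norm_num
  obtain rfl : κ = α + β + γ - 1 := by linarith
  rcases le_total i j with hij | hij <;> rcases le_total i l with hil | hil <;>
    rcases le_total j l with hjl | hjl
  · apply key _ b1
    rw [abs_of_nonpos (by linarith), abs_of_nonpos (by linarith)]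
    nlinarith
  · apply key _ b3
    rw [abs_of_nonpos (by linarith), abs_of_nonpos (by linarith)]
    nlinarith
  · apply key _ b4
    rw [abs_of_nonpos (by linarith), abs_of_nonneg (by linarith)]
    nlinarith
  · apply key _ b4
    rw [abs_of_nonpos (by linarith), abs_of_nonneg (by linarith)]
    nlinarith
  · apply key _ b2
    rw [abs_of_nonneg (by linarith), abs_of_nonpos (by linarith)]
    nlinarith
  · apply key _ b2
    rw [abs_of_nonneg (by linarith), abs_of_nonpos (by linarith)]
    nlinarith
  · apply key _ b5
    rw [abs_of_nonneg (by linarith), abs_of_nonneg (by linarith)]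
    nlinarith
  · apply key _ b6
    rw [abs_of_nonneg (by linarith), abs_of_nonneg (by linarith)]
    nlinarith

theorem rpow_mul_rpow_mul_rpow_le_add {a b c : ℝ≥0∞} {u v w : ℝ} (hu : 0 ≤ u) (hv : 0 ≤ v)
    (hw : 0 ≤ w) (h : u + v + w = 1) : a ^ u * b ^ v * c ^ w ≤ a + b + c := by
  calc a ^ u * b ^ v * c ^ w ≤ (a + b + c) ^ u * (a + b + c) ^ v * (a + b + c) ^ w := by
        gcongr
        · rw [add_assoc]; exact le_self_add
        · rw [add_comm a b, add_assoc]; exact le_self_add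
        · exact le_add_self
    _ = a + b + c := by
        rw [← ENNReal.rpow_add_of_nonneg _ _ hu hv,
          ← ENNReal.rpow_add_of_nonneg _ _ (add_nonneg hu hv) hw, h, ENNReal.rpow_one]

/-- A trilinear form on sequences with a kernel decaying off the diagonal obeys Hölder's
inequality. -/
theorem tsum_trilinear_le {α β γ ε u v w : ℝ} (hu : 0 ≤ u) (hv : 0 ≤ v)
    (hw : 0 ≤ w) (h : u + v + w = 1) {x y z a b c : ℤ → ℝ≥0∞} {A B D C : ℝ≥0∞}
    {L : ℤ → ℤ → ℤ → ℝ≥0∞}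
    (hx : ∀ i : ℤ, x i ≤ A * (2 : ℝ≥0∞) ^ (-(α * i)) * a i ^ u)
    (hy : ∀ i : ℤ, y i ≤ B * (2 : ℝ≥0∞) ^ (-(β * i)) * b i ^ v)
    (hz : ∀ i : ℤ, z i ≤ D * (2 : ℝ≥0∞) ^ (-(γ * i)) * c i ^ w)
    (ha : ∑' i, a i ≤ 1) (hb : ∑' i, b i ≤ 1) (hc : ∑' i, c i ≤ 1)
    (hL : ∀ i j l : ℤ, L i j l ≤ C * (2 : ℝ≥0∞) ^ (α * (i : ℝ) + β * j + γ * l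
      - ε * |(i : ℝ) - j| - ε * |(i : ℝ) - l|)) :
    ∑' i, ∑' j, ∑' l, x i * y j * z l * L i j l
      ≤ C * A * B * D * (3 * (∑' m : ℤ, (2 : ℝ≥0∞) ^ (-(ε * |(m : ℝ)|))) ^ 2) := by
  set S := ∑' m : ℤ, (2 : ℝ≥0∞) ^ (-(ε * |(m : ℝ)|)) with hS
  set k : ℤ → ℤ → ℝ≥0∞ := fun i j => (2 : ℝ≥0∞) ^ (-(ε * |(i : ℝ) - j|)) with hk
  have hk1 : ∀ i, ∑' j, k i j = S := fun i => tsum_two_rpow_neg_abs_sub ε i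
  have hk2 : ∀ j, ∑' i, k i j = S := fun j => tsum_two_rpow_neg_abs_sub' ε j
  have hterm : ∀ i j l, x i * y j * z l * L i j l
      ≤ C * A * B * D * (k i j * k i l * (a i + b j + c l)) := by
    intro i j l
    have e : (2 : ℝ≥0∞) ^ (α * (i : ℝ) + β * j + γ * l - ε * |(i : ℝ) - j| - ε * |(i : ℝ) - l|)
        * ((2 : ℝ≥0∞) ^ (-(α * (i : ℝ))) * (2 : ℝ≥0∞) ^ (-(β * (j : ℝ)))
          * (2 : ℝ≥0∞) ^ (-(γ * (l : ℝ)))) = k i j * k i l := by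
      simp only [hk]
      simp_rw [← ENNReal.rpow_add _ _ (two_ne_zero : (2 : ℝ≥0∞) ≠ 0) ENNReal.ofNat_ne_top]
      congr 1
      ring
    calc x i * y j * z l * L i j l
        ≤ (A * (2 : ℝ≥0∞) ^ (-(α * i)) * a i ^ u) * (B * (2 : ℝ≥0∞) ^ (-(β * j)) * b j ^ v) *
          (D * (2 : ℝ≥0∞) ^ (-(γ * l)) * c l ^ w) * (C * (2 : ℝ≥0∞) ^ (α * (i : ℝ) + β * j + γ * l
      - ε * |(i : ℝ) - j| - ε * |(i : ℝ) - l|)) := by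
          gcongr
          exacts [hx i, hy j, hz l, hL i j l]
      _ = C * A * B * D * ((2 : ℝ≥0∞) ^ (α * (i : ℝ) + β * j + γ * l - ε * |(i : ℝ) - j|
          - ε * |(i : ℝ) - l|) * ((2 : ℝ≥0∞) ^ (-(α * (i : ℝ))) * (2 : ℝ≥0∞) ^ (-(β * (j : ℝ)))
          * (2 : ℝ≥0∞) ^ (-(γ * (l : ℝ)))) * (a i ^ u * b j ^ v * c l ^ w)) := by ring
      _ ≤ _ := by
          rw [e]
          gcongr
          exact rpow_mul_rpow_mul_rpow_le_add hu hv hw h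
  have h1 : ∑' i, ∑' j, ∑' l, k i j * k i l * a i = S ^ 2 * ∑' i, a i := by
    simp_rw [ENNReal.tsum_mul_right, ENNReal.tsum_mul_left, ENNReal.tsum_mul_right, hk1,
      ENNReal.tsum_mul_left, sq]
  have h2 : ∑' i, ∑' j, ∑' l, k i j * k i l * b j = S ^ 2 * ∑' j, b j := by
    simp_rw [ENNReal.tsum_mul_right, ENNReal.tsum_mul_left, hk1]
    rw [ENNReal.tsum_comm]
    simp_rw [ENNReal.tsum_mul_right, hk2, ENNReal.tsum_mul_left, sq]
  have h3 : ∑' i, ∑' j, ∑' l, k i j * k i l * c l = S ^ 2 * ∑' l, c l := by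
    simp_rw [mul_assoc, ENNReal.tsum_mul_left, ENNReal.tsum_mul_right, hk1,
      ENNReal.tsum_mul_left]
    rw [ENNReal.tsum_comm]
    simp_rw [ENNReal.tsum_mul_right, hk2, ENNReal.tsum_mul_left, sq, mul_assoc]
  calc _ ≤ ∑' i, ∑' j, ∑' l, C * A * B * D * (k i j * k i l * (a i + b j + c l)) :=
        ENNReal.tsum_le_tsum fun i => ENNReal.tsum_le_tsum fun j => ENNReal.tsum_le_tsum fun l =>
          hterm i j l
    _ = C * A * B * D * (S ^ 2 * ∑' i, a i + S ^ 2 * ∑' j, b j + S ^ 2 * ∑' l, c l) := by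
        simp_rw [ENNReal.tsum_mul_left, mul_add, ENNReal.tsum_add, h1, h2, h3]
        ring
    _ ≤ C * A * B * D * (S ^ 2 * 1 + S ^ 2 * 1 + S ^ 2 * 1) := by gcongr
    _ = _ := by ring

end DiscreteForm

section DivCurl

variable {n : ℕ}

local notation "𝔼" => EuclideanSpace ℝ (Fin n)

theorem sum_mul_apply_single (L : 𝔼 →L[ℝ] ℝ) (v : 𝔼) :
    ∑ a, v a * L (EuclideanSpace.single a 1) = L v := by
  conv_rhs => rw [← (EuclideanSpace.basisFun (Fin n) ℝ).sum_repr v]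
  simp

theorem integral_fderiv_apply_eq_zero {F : 𝔼 → 𝔼} (hF : ContDiff ℝ 1 F)
    (hdiv : ∀ x, ∑ a, fderiv ℝ F x (EuclideanSpace.single a 1) a = 0)
    {φ : 𝔼 → ℝ} (hφ : ContDiff ℝ 1 φ) (hc : HasCompactSupport φ) :
    ∫ x, fderiv ℝ φ x (F x) = 0 := by
  have hd : ∀ x, DifferentiableAt ℝ F x := fun x => hF.differentiable one_ne_zero x
  have hF1 := hF.continuous_fderiv one_ne_zero
  have hφ1 := hφ.continuous_fderiv one_ne_zero
  have hFc := hF.continuous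
  have hφc := hφ.continuous
  have hFa : ∀ (a : Fin n) (x : 𝔼), HasFDerivAt (fun x => F x a)
      ((EuclideanSpace.proj a).comp (fderiv ℝ F x)) x := fun a x =>
    (EuclideanSpace.proj (𝕜 := ℝ) a).hasFDerivAt.comp x (hd x).hasFDerivAt
  have hcoord : ∀ (a : Fin n) (x v : 𝔼), fderiv ℝ (fun x => F x a) x v = fderiv ℝ F x v a :=
    fun a x v => by rw [(hFa a x).fderiv]; rfl
  have hcd : ∀ v : 𝔼, HasCompactSupport fun x => fderiv ℝ φ x v := fun v =>
    hc.fderiv_apply (𝕜 := ℝ) v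
  have i1 : ∀ a : Fin n, Integrable fun x => F x a * fderiv ℝ φ x (EuclideanSpace.single a 1) :=
    fun a => Continuous.integrable_of_hasCompactSupport (by fun_prop) ((hcd _).mul_left)
  have i2 : ∀ a : Fin n, Integrable fun x => fderiv ℝ F x (EuclideanSpace.single a 1) a * φ x :=
    fun a => Continuous.integrable_of_hasCompactSupport (by fun_prop) hc.mul_left
  have ibp : ∀ a : Fin n, ∫ x, F x a * fderiv ℝ φ x (EuclideanSpace.single a 1) =
      -∫ x, fderiv ℝ F x (EuclideanSpace.single a 1) a * φ x := by
    intro a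
    have := integral_mul_fderiv_eq_neg_fderiv_mul_of_integrable (μ := (volume : Measure 𝔼))
      (f := fun x => F x a) (g := φ) (v := EuclideanSpace.single a 1)
      (by simpa only [hcoord] using i2 a) (i1 a)
      (Continuous.integrable_of_hasCompactSupport (by fun_prop) hc.mul_left)
      (fun x _ => (hFa a x).differentiableAt) (fun x _ => hφ.differentiable one_ne_zero x)
    simpa only [hcoord] using this
  simp_rw [← sum_mul_apply_single (fderiv ℝ φ _) (F _)]
  rw [integral_finsetSum _ fun a _ => i1 a]
  simp_rw [ibp]
  rw [Finset.sum_neg_distrib, ← integral_finsetSum _ fun a _ => i2 a]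
  simp_rw [← Finset.sum_mul, hdiv]
  simp

/-- Integration by parts along a divergence-free vector field. -/
theorem integral_fderiv_apply_mul {F : 𝔼 → 𝔼} (hF : ContDiff ℝ 1 F)
    (hdiv : ∀ x, ∑ a, fderiv ℝ F x (EuclideanSpace.single a 1) a = 0)
    {f k : 𝔼 → ℝ} (hf : ContDiff ℝ 1 f) (hk : ContDiff ℝ 1 k) (hc : HasCompactSupport k) :
    ∫ x, fderiv ℝ f x (F x) * k x = -∫ x, f x * fderiv ℝ k x (F x) := by
  have hf1 := hf.continuous_fderiv one_ne_zero
  have hk1 := hk.continuous_fderiv one_ne_zero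
  have hFc := hF.continuous
  have hfc := hf.continuous
  have hkc := hk.continuous
  have h0 := integral_fderiv_apply_eq_zero hF hdiv (hf.mul hk) hc.mul_left
  have e : ∀ x, fderiv ℝ (f * k) x (F x) =
      fderiv ℝ f x (F x) * k x + f x * fderiv ℝ k x (F x) := fun x => by
    rw [((hf.differentiable one_ne_zero x).hasFDerivAt.mul
      (hk.differentiable one_ne_zero x).hasFDerivAt).fderiv]
    simp
    ring
  have hck : HasCompactSupport fun x => fderiv ℝ k x (F x) :=
    (hc.fderiv (𝕜 := ℝ)).mono fun x hx h => hx (by simp_all)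
  change ∫ x, fderiv ℝ (f * k) x (F x) = 0 at h0
  simp_rw [e] at h0
  rw [integral_add (f := fun x => fderiv ℝ f x (F x) * k x)
    (g := fun x => f x * fderiv ℝ k x (F x))
    (Continuous.integrable_of_hasCompactSupport (by fun_prop) hc.mul_left)
    (Continuous.integrable_of_hasCompactSupport (by fun_prop) hck.mul_left)] at h0
  linarith

theorem integral_sub_integral_eq_intervalIntegral {Φ Ψ : ℝ → 𝔼 → ℝ} {T : ℝ} (hT : 0 ≤ T)
    (hΦ : ∀ t x, HasDerivAt (fun s => Φ s x) (Ψ t x) t)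
    (hΨ : Continuous fun z : ℝ × 𝔼 => Ψ z.1 z.2) {K : Set 𝔼} (hK : IsCompact K)
    (hΨK : ∀ t ∈ Set.Icc 0 T, ∀ x ∉ K, Ψ t x = 0) (h0 : Integrable (Φ 0)) (h1 : Integrable (Φ T)) :
    (∫ x, Φ T x) - ∫ x, Φ 0 x = ∫ t in Set.Ioc 0 T, ∫ x, Ψ t x := by
  have h_int : Integrable (Function.uncurry Ψ) ((volume.restrict (Set.Ioc 0 T)).prod volume) := by
    have h := (hΨ.continuousOn.integrableOn_compact (μ := (volume : Measure (ℝ × 𝔼)))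
      (isCompact_Icc.prod hK)).of_forall_sdiff_eq_zero
      (t := Set.Icc 0 T ×ˢ Set.univ) (measurableSet_Icc.prod .univ)
      fun z hz => hΨK _ hz.1.1 _ fun h => hz.2 ⟨hz.1.1, h⟩
    have h2 := h.mono_set (Set.prod_mono_left (Set.Ioc_subset_Icc_self (a := 0) (b := T)))
    rwa [IntegrableOn, Measure.volume_eq_prod, ← Measure.prod_restrict, Measure.restrict_univ] at h2
  rw [← integral_sub h1 h0, integral_integral_swap h_int]
  congr 1
  ext x
  rw [← intervalIntegral.integral_of_le hT]
  refine (intervalIntegral.integral_eq_sub_of_hasDerivAt (f := fun s => Φ s x)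
    (fun t _ => hΦ t x) ?_).symm
  exact (hΨ.comp (by fun_prop : Continuous fun t : ℝ => (t, x))).intervalIntegrable _ _

theorem HasCompactSupport.comp_sub_right {β : Type*} [Zero β] {f : 𝔼 → β}
    (hf : HasCompactSupport f) (a : 𝔼) : HasCompactSupport fun x => f (x - a) :=
  hf.comp_homeomorph (Homeomorph.subRight a)

theorem hasDerivAt_fderiv_mul_translate {g h : 𝔼 → ℝ} (hg : ContDiff ℝ 2 g)
    (hh : ContDiff ℝ 1 h) (b c x v : 𝔼) (t : ℝ) :
    HasDerivAt (fun s : ℝ => fderiv ℝ g (x - s • c) v * h (x - s • b))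
      (-(fderiv ℝ (fderiv ℝ g) (x - t • c) c v * h (x - t • b)) -
        fderiv ℝ g (x - t • c) v * fderiv ℝ h (x - t • b) b) t := by
  have hg' : ContDiff ℝ 1 (fderiv ℝ g) := hg.fderiv_right (by norm_num)
  have hline : ∀ a : 𝔼, HasDerivAt (fun s : ℝ => x - s • a) (-a) t := fun a => by
    simpa using ((hasDerivAt_id t).smul_const a).const_sub x
  have d1 : HasDerivAt (fun s : ℝ => fderiv ℝ g (x - s • c))
      (fderiv ℝ (fderiv ℝ g) (x - t • c) (-c)) t :=
    (hg'.differentiable one_ne_zero (x - t • c)).hasFDerivAt.comp_hasDerivAt t (hline c)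
  have d2 : HasDerivAt (fun s : ℝ => fderiv ℝ g (x - s • c) v)
      (fderiv ℝ (fderiv ℝ g) (x - t • c) (-c) v) t := by
    simpa using d1.clm_apply (hasDerivAt_const t v)
  have d3 : HasDerivAt (fun s : ℝ => h (x - s • b)) (fderiv ℝ h (x - t • b) (-b)) t :=
    (hh.differentiable one_ne_zero (x - t • b)).hasFDerivAt.comp_hasDerivAt t (hline b)
  refine (d2.fun_mul d3).congr_deriv ?_
  simp
  ring

theorem integral_translate_deriv_eq {F : 𝔼 → 𝔼} (hF : ContDiff ℝ 1 F)
    (hdiv : ∀ x, ∑ a, fderiv ℝ F x (EuclideanSpace.single a 1) a = 0)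
    {g h : 𝔼 → ℝ} (hg : ContDiff ℝ 2 g) (hh : ContDiff ℝ 1 h) (hhc : HasCompactSupport h)
    (b c : 𝔼) (t : ℝ) :
    ∫ x, (-(fderiv ℝ (fderiv ℝ g) (x - t • c) c (F x) * h (x - t • b)) -
        fderiv ℝ g (x - t • c) (F x) * fderiv ℝ h (x - t • b) b) =
      ∫ x, (fderiv ℝ g (x - t • c) c * fderiv ℝ h (x - t • b) (F x) -
        fderiv ℝ g (x - t • c) (F x) * fderiv ℝ h (x - t • b) b) := by
  have hFc := hF.continuous
  have hhC := hh.continuous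
  have hg' : ContDiff ℝ 1 (fderiv ℝ g) := hg.fderiv_right (by norm_num)
  have hg1 := hg'.continuous
  have hh1 := hh.continuous_fderiv one_ne_zero
  have hg2 := hg'.continuous_fderiv one_ne_zero
  have hhs : HasCompactSupport fun x => h (x - t • b) := hhc.comp_sub_right _
  have hhs1 : HasCompactSupport fun x => fderiv ℝ h (x - t • b) :=
    (hhc.fderiv (𝕜 := ℝ)).comp_sub_right _
  have hfd : ∀ x, fderiv ℝ (fun y => fderiv ℝ g (y - t • c) c) x (F x) =
      fderiv ℝ (fderiv ℝ g) (x - t • c) c (F x) := fun x => by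
    have hs : IsSymmSndFDerivAt ℝ g (x - t • c) :=
      hg.contDiffAt.isSymmSndFDerivAt (by simp)
    rw [hs.eq]
    have d1 : HasFDerivAt (fun y => fderiv ℝ g (y - t • c))
        (fderiv ℝ (fderiv ℝ g) (x - t • c)) x :=
      (hasFDerivAt_comp_sub (t • c)).2 (hg'.differentiable one_ne_zero (x - t • c)).hasFDerivAt
    rw [(d1.clm_apply (hasFDerivAt_const c x)).fderiv]
    simp
  have hkd : ∀ x, fderiv ℝ (fun y => h (y - t • b)) x = fderiv ℝ h (x - t • b) := fun x =>
    fderiv_comp_sub _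
  have ibp := integral_fderiv_apply_mul hF hdiv (f := fun y => fderiv ℝ g (y - t • c) c)
    (k := fun y => h (y - t • b)) (by fun_prop) (hh.comp (by fun_prop))
    hhs
  simp_rw [hfd, hkd] at ibp
  have hs2 : HasCompactSupport fun x => fderiv ℝ h (x - t • b) (F x) :=
    hhs1.mono fun x hx hz => hx (by simp_all)
  have hs3 : HasCompactSupport fun x => fderiv ℝ h (x - t • b) b :=
    hhs1.mono fun x hx hz => hx (by simp_all)
  have i1 : Integrable fun x => fderiv ℝ (fderiv ℝ g) (x - t • c) c (F x) * h (x - t • b) :=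
    Continuous.integrable_of_hasCompactSupport (by fun_prop) hhs.mul_left
  have i2 : Integrable fun x => fderiv ℝ g (x - t • c) (F x) * fderiv ℝ h (x - t • b) b :=
    Continuous.integrable_of_hasCompactSupport (by fun_prop) hs3.mul_left
  have i3 : Integrable fun x => fderiv ℝ g (x - t • c) c * fderiv ℝ h (x - t • b) (F x) :=
    Continuous.integrable_of_hasCompactSupport (by fun_prop) hs2.mul_left
  rw [integral_sub (f := fun x => -(fderiv ℝ (fderiv ℝ g) (x - t • c) c (F x) * h (x - t • b)))
    i1.neg i2, integral_sub i3 i2, integral_neg, ibp, neg_neg]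

/-- Translating `g` and `h` independently changes the div-curl form by an amount controlled by
`|F|`, `|∇g|` and `|∇h|`. -/
theorem enorm_integral_fderiv_mul_le {F : 𝔼 → 𝔼} (hF : ContDiff ℝ 1 F)
    (hdiv : ∀ x, ∑ a, fderiv ℝ F x (EuclideanSpace.single a 1) a = 0)
    {g h : 𝔼 → ℝ} (hg : ContDiff ℝ 2 g)
    (hh : ContDiff ℝ 2 h) (hhc : HasCompactSupport h) {b c : 𝔼} (hb : ‖b‖ ≤ 1) (hc : ‖c‖ ≤ 1)
    {T : ℝ} (hT : 0 ≤ T) :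
    ‖∫ x, fderiv ℝ g x (F x) * h x‖ₑ ≤
      ‖∫ x, fderiv ℝ g (x - T • c) (F x) * h (x - T • b)‖ₑ +
      ∫⁻ t in Set.Ioi (0 : ℝ), ∫⁻ x,
        2 * (‖F x‖ₑ * ‖fderiv ℝ g (x - t • c)‖ₑ * ‖fderiv ℝ h (x - t • b)‖ₑ) := by
  have hFc := hF.continuous
  have hhC := hh.continuous
  have hg' : ContDiff ℝ 1 (fderiv ℝ g) := hg.fderiv_right (by norm_num)
  have hh' : ContDiff ℝ 1 (fderiv ℝ h) := hh.fderiv_right (by norm_num)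
  have hg1 := hg'.continuous
  have hh1 := hh'.continuous
  have hg2 := hg'.continuous_fderiv one_ne_zero
  have hgd : Differentiable ℝ g := hg.differentiable two_ne_zero
  have hhd : Differentiable ℝ h := hh.differentiable two_ne_zero
  set Φ : ℝ → 𝔼 → ℝ := fun t x => fderiv ℝ g (x - t • c) (F x) * h (x - t • b) with hΦ
  set Ψ : ℝ → 𝔼 → ℝ := fun t x => -(fderiv ℝ (fderiv ℝ g) (x - t • c) c (F x) * h (x - t • b)) -
    fderiv ℝ g (x - t • c) (F x) * fderiv ℝ h (x - t • b) b with hΨ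
  have hderiv : ∀ t x, HasDerivAt (fun s => Φ s x) (Ψ t x) t := fun t x =>
    hasDerivAt_fderiv_mul_translate hg (hh.of_le (by norm_num)) b c x (F x) t
  have hhs : ∀ t : ℝ, HasCompactSupport fun x => h (x - t • b) := fun t => hhc.comp_sub_right _
  have hΨcont : Continuous fun z : ℝ × 𝔼 => Ψ z.1 z.2 := by simp only [hΨ]; fun_prop
  have hΦint : ∀ t, Integrable (Φ t) := fun t =>
    Continuous.integrable_of_hasCompactSupport (by simp only [hΦ]; fun_prop) (hhs t).mul_left
  obtain ⟨R, hR⟩ := hhc.isCompact.isBounded.subset_closedBall (0 : 𝔼)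
  have hzero : ∀ t ∈ Set.Icc 0 T, ∀ x ∉ closedBall (0 : 𝔼) (R + T), Ψ t x = 0 := by
    intro t ht x hx
    have hout : x - t • b ∉ tsupport h := fun hm => by
      have h1 := hR hm
      rw [mem_closedBall_zero_iff] at h1 hx
      have h2 : ‖t • b‖ ≤ T := by
        rw [norm_smul, Real.norm_of_nonneg ht.1]
        nlinarith [ht.1, ht.2, norm_nonneg b]
      have h3 := norm_add_le (x - t • b) (t • b)
      rw [sub_add_cancel] at h3
      linarith
    have h1 : h (x - t • b) = 0 := image_eq_zero_of_notMem_tsupport hout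
    have h2 : fderiv ℝ h (x - t • b) = 0 := by
      by_contra hne
      exact hout (support_fderiv_subset ℝ hne)
    simp [hΨ, h1, h2]
  have hftc := integral_sub_integral_eq_intervalIntegral hT hderiv hΨcont
    (isCompact_closedBall (0 : 𝔼) (R + T)) hzero (hΦint 0) (hΦint T)
  have hparts : ∀ t : ℝ, ∫ x, Ψ t x = ∫ x, (fderiv ℝ g (x - t • c) c *
      fderiv ℝ h (x - t • b) (F x) - fderiv ℝ g (x - t • c) (F x) * fderiv ℝ h (x - t • b) b) :=
    fun t => integral_translate_deriv_eq hF hdiv hg (hh.of_le (by norm_num)) hhc b c t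
  have hbound : ∀ t : ℝ, ‖∫ x, Ψ t x‖ₑ ≤ ∫⁻ x,
      2 * (‖F x‖ₑ * ‖fderiv ℝ g (x - t • c)‖ₑ * ‖fderiv ℝ h (x - t • b)‖ₑ) := by
    intro t
    rw [hparts]
    refine (enorm_integral_le_lintegral_enorm _).trans (lintegral_mono fun x => ?_)
    have hce : ‖c‖ₑ ≤ 1 := by
      rw [← ofReal_norm]; exact ENNReal.ofReal_le_one.2 hc
    have hbe : ‖b‖ₑ ≤ 1 := by
      rw [← ofReal_norm]; exact ENNReal.ofReal_le_one.2 hb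
    refine enorm_sub_le.trans ?_
    rw [enorm_mul, enorm_mul, two_mul]
    refine add_le_add ?_ ?_
    · calc _ ≤ (‖fderiv ℝ g (x - t • c)‖ₑ * 1) * (‖fderiv ℝ h (x - t • b)‖ₑ * ‖F x‖ₑ) :=
            mul_le_mul' ((ContinuousLinearMap.le_opENorm _ _).trans (mul_le_mul' le_rfl hce))
              (ContinuousLinearMap.le_opENorm _ _)
        _ = _ := by ring
    · calc _ ≤ (‖fderiv ℝ g (x - t • c)‖ₑ * ‖F x‖ₑ) * (‖fderiv ℝ h (x - t • b)‖ₑ * 1) :=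
            mul_le_mul' (ContinuousLinearMap.le_opENorm _ _)
              ((ContinuousLinearMap.le_opENorm _ _).trans (mul_le_mul' le_rfl hbe))
        _ = _ := by ring
  have h0 : ∫ x, fderiv ℝ g x (F x) * h x = ∫ x, Φ 0 x := by simp [hΦ]
  rw [h0, ← sub_sub_cancel (∫ x, Φ T x) (∫ x, Φ 0 x), hftc]
  refine enorm_sub_le.trans (add_le_add le_rfl ?_)
  refine (enorm_integral_le_lintegral_enorm _).trans ((lintegral_mono hbound).trans ?_)
  exact lintegral_mono_set Set.Ioc_subset_Ioi_self

end DivCurl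

section Averages

variable {n : ℕ}

local notation "𝔼" => EuclideanSpace ℝ (Fin n)
local notation "𝔹" => Metric.ball (0 : EuclideanSpace ℝ (Fin n)) 1

theorem lintegral_comp_sub_smul {u : 𝔼 → ℝ≥0∞} (hu : Measurable u) {t : ℝ} (ht : 0 < t) (d : 𝔼) :
    ∫⁻ b : 𝔼, u (d - t • b) = ENNReal.ofReal (t ^ (-(n : ℝ))) * ∫⁻ y, u y := by
  have h := Measure.map_addHaar_smul (volume : Measure 𝔼) ht.ne'
  calc ∫⁻ b : 𝔼, u (d - t • b)
      = ∫⁻ y, u (d - y) ∂(Measure.map (fun b : 𝔼 => t • b) volume) :=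
        (lintegral_map (f := fun y => u (d - y)) (by fun_prop) (measurable_const_smul t)).symm
    _ = ENNReal.ofReal (t ^ (-(n : ℝ))) * ∫⁻ y, u (d - y) := by
        rw [h, lintegral_smul_measure, smul_eq_mul, finrank_euclideanSpace_fin,
          Real.rpow_neg ht.le, Real.rpow_natCast, abs_of_pos (by positivity)]
    _ = _ := by rw [lintegral_sub_left_eq_self u d]

theorem setLIntegral_lintegral_mul_comp_le {f u : 𝔼 → ℝ≥0∞} (hf : Measurable f) (hu : Measurable u)
    {t : ℝ} (ht : 0 < t) (e : 𝔼) :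
    ∫⁻ b in 𝔹, ∫⁻ y, f y * u (y + t • e - t • b)
      ≤ (∫⁻ y, f y) * (ENNReal.ofReal (t ^ (-(n : ℝ))) * ∫⁻ y, u y) := by
  rw [lintegral_lintegral_swap (by fun_prop), ← lintegral_mul_const _ hf]
  refine lintegral_mono fun y => ?_
  dsimp only
  rw [lintegral_const_mul _ (by fun_prop)]
  gcongr
  exact (setLIntegral_le_lintegral _ _).trans_eq (lintegral_comp_sub_smul hu ht _)

theorem lintegral_mul_comp_shift (f u : 𝔼 → ℝ≥0∞) (e b : 𝔼) (t : ℝ) :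
    ∫⁻ y, f y * u (y + t • e - t • b) = ∫⁻ y, f (y - t • e + t • b) * u y := by
  rw [← lintegral_add_right_eq_self (fun y => f (y - t • e + t • b) * u y) (t • e - t • b)]
  congr 1
  ext y
  congr 2 <;> abel

theorem setLIntegral_lintegral_mul_comp_le' {f u : 𝔼 → ℝ≥0∞} (hf : Measurable f)
    {M : ℝ≥0∞} (hM : ∀ y, u y ≤ M) (t : ℝ) (e : 𝔼) :
    ∫⁻ b in 𝔹, ∫⁻ y, f y * u (y + t • e - t • b) ≤ (∫⁻ y, f y) * (M * volume 𝔹) := by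
  calc _ ≤ ∫⁻ b in 𝔹, ∫⁻ y, f y * M := by gcongr; exact hM _
    _ = _ := by rw [lintegral_mul_const _ hf, setLIntegral_const, mul_assoc]

theorem setLIntegral_lintegral_mul_comp_le'' {f u : 𝔼 → ℝ≥0∞} (hu : Measurable u)
    {M : ℝ≥0∞} (hM : ∀ y, f y ≤ M) (t : ℝ) (e : 𝔼) :
    ∫⁻ b in 𝔹, ∫⁻ y, f y * u (y + t • e - t • b) ≤ (∫⁻ y, u y) * (M * volume 𝔹) := by
  simp_rw [lintegral_mul_comp_shift]
  calc _ ≤ ∫⁻ b in 𝔹, ∫⁻ y, M * u y := by gcongr; exact hM _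
    _ = _ := by rw [lintegral_const_mul _ hu, setLIntegral_const]; ring

theorem lintegral_min_rpow_le (hn : 2 ≤ n) (v : ℝ≥0∞) (y : ℝ) :
    ∫⁻ t in Set.Ioi (0 : ℝ), min v (ENNReal.ofReal (t ^ (-(n : ℝ))) * (2 : ℝ≥0∞) ^ y)
      ≤ (v + 1) * (2 : ℝ≥0∞) ^ (1 / (n : ℝ) * y) := by
  have hn' : (2 : ℝ) ≤ n := by exact_mod_cast hn
  set τ : ℝ := (2 : ℝ) ^ (1 / (n : ℝ) * y) with hτ
  have hτ0 : 0 < τ := by positivity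
  have h2 : ∀ z : ℝ, (2 : ℝ≥0∞) ^ z = ENNReal.ofReal ((2 : ℝ) ^ z) := fun z => by
    rw [← ENNReal.ofReal_rpow_of_pos (by norm_num)]; norm_num
  have hy : (2 : ℝ) ^ y = τ ^ (n : ℝ) := by
    rw [hτ, ← Real.rpow_mul (by norm_num)]
    congr 1
    field_simp
  have h_int : ∫⁻ t in Set.Ioi τ, ENNReal.ofReal (t ^ (-(n : ℝ)))
      = ENNReal.ofReal (-τ ^ (-(n : ℝ) + 1) / (-(n : ℝ) + 1)) := by
    rw [← ofReal_integral_eq_lintegral_ofReal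
      (integrableOn_Ioi_rpow_of_lt (by linarith) hτ0), integral_Ioi_rpow_of_lt (by linarith) hτ0]
    filter_upwards [ae_restrict_mem measurableSet_Ioi] with t ht
    exact Real.rpow_nonneg (hτ0.trans ht).le _
  have hu : Set.Ioi (0 : ℝ) ⊆ Set.Ioc 0 τ ∪ Set.Ioi τ := by
    rw [Set.Ioc_union_Ioi_eq_Ioi hτ0.le]
  calc _ ≤ ∫⁻ t in Set.Ioc 0 τ ∪ Set.Ioi τ,
        min v (ENNReal.ofReal (t ^ (-(n : ℝ))) * (2 : ℝ≥0∞) ^ y) := lintegral_mono_set hu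
    _ ≤ (∫⁻ t in Set.Ioc 0 τ, min v (ENNReal.ofReal (t ^ (-(n : ℝ))) * (2 : ℝ≥0∞) ^ y))
        + ∫⁻ t in Set.Ioi τ, min v (ENNReal.ofReal (t ^ (-(n : ℝ))) * (2 : ℝ≥0∞) ^ y) :=
        lintegral_union_le _ _ _
    _ ≤ (∫⁻ t in Set.Ioc 0 τ, v)
        + ∫⁻ t in Set.Ioi τ, ENNReal.ofReal (t ^ (-(n : ℝ))) * (2 : ℝ≥0∞) ^ y := by
        gcongr
        · exact min_le_left _ _
        · exact min_le_right _ _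
    _ ≤ v * ENNReal.ofReal τ + ENNReal.ofReal τ := by
        rw [setLIntegral_const, Real.volume_Ioc, sub_zero, lintegral_mul_const _ (by fun_prop),
          h_int,
          h2, ← ENNReal.ofReal_mul' (by positivity), hy]
        gcongr
        have e : -τ ^ (-(n : ℝ) + 1) / (-(n : ℝ) + 1) * τ ^ (n : ℝ) = τ / (n - 1) := by
          rw [Real.rpow_add hτ0, Real.rpow_neg hτ0.le, Real.rpow_one]
          have : τ ^ (n : ℝ) ≠ 0 := by positivity
          have h3 : (n : ℝ) - 1 ≠ 0 := by linarith
          have h4 : -(n : ℝ) + 1 ≠ 0 := by linarith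
          field_simp
          ring
        rw [e]
        exact div_le_self hτ0.le (by linarith)
    _ = _ := by rw [h2, add_mul, one_mul]

theorem setLIntegral_pair_le (hn : 2 ≤ n) {X Y : Set 𝔼} (hX : MeasurableSet X)
    (hY : MeasurableSet Y) {x y : ℝ} (hx : volume X ≤ (2 : ℝ≥0∞) ^ x)
    (hy : volume Y ≤ (2 : ℝ≥0∞) ^ y) (e : 𝔼) :
    ∫⁻ b in 𝔹, ∫⁻ t in Set.Ioi (0 : ℝ), ∫⁻ z,
        X.indicator 1 z * Y.indicator 1 (z + t • e - t • b)
      ≤ (volume 𝔹 + 1) * (2 : ℝ≥0∞) ^ (x + 1 / (n : ℝ) * y) ∧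
    ∫⁻ b in 𝔹, ∫⁻ t in Set.Ioi (0 : ℝ), ∫⁻ z,
        X.indicator 1 z * Y.indicator 1 (z + t • e - t • b)
      ≤ (volume 𝔹 + 1) * (2 : ℝ≥0∞) ^ (y + 1 / (n : ℝ) * x) := by
  have hXm : Measurable (X.indicator (1 : 𝔼 → ℝ≥0∞)) := measurable_one.indicator hX
  have hYm : Measurable (Y.indicator (1 : 𝔼 → ℝ≥0∞)) := measurable_one.indicator hY
  have hXi : ∫⁻ z, X.indicator (1 : 𝔼 → ℝ≥0∞) z = volume X := lintegral_indicator_one hX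
  have hYi : ∫⁻ z, Y.indicator (1 : 𝔼 → ℝ≥0∞) z = volume Y := lintegral_indicator_one hY
  have hX1 : ∀ z, X.indicator (1 : 𝔼 → ℝ≥0∞) z ≤ 1 := fun z =>
    Set.indicator_le_self' (fun _ _ => zero_le) z
  have hY1 : ∀ z, Y.indicator (1 : 𝔼 → ℝ≥0∞) z ≤ 1 := fun z =>
    Set.indicator_le_self' (fun _ _ => zero_le) z
  have hm : Measurable fun w : (𝔼 × ℝ) × 𝔼 =>
      X.indicator (1 : 𝔼 → ℝ≥0∞) w.2 *
        Y.indicator (1 : 𝔼 → ℝ≥0∞) (w.2 + w.1.2 • e - w.1.2 • w.1.1) :=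
    (hXm.comp (by fun_prop)).mul (hYm.comp (by fun_prop))
  rw [lintegral_lintegral_swap hm.lintegral_prod_right'.aemeasurable]
  have h2 : ∀ a b : ℝ, (2 : ℝ≥0∞) ^ (a + b) = (2 : ℝ≥0∞) ^ a * (2 : ℝ≥0∞) ^ b := fun a b =>
    ENNReal.rpow_add _ _ two_ne_zero ENNReal.ofNat_ne_top
  have b1 : ∀ t : ℝ, 0 < t → ∫⁻ b in 𝔹, ∫⁻ z,
      X.indicator 1 z * Y.indicator 1 (z + t • e - t • b) ≤
      volume X * (ENNReal.ofReal (t ^ (-(n : ℝ))) * volume Y) := fun t ht =>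
    (setLIntegral_lintegral_mul_comp_le hXm hYm ht e).trans_eq (by rw [hXi, hYi])
  have b2 : ∀ t : ℝ, ∫⁻ b in 𝔹, ∫⁻ z,
      X.indicator 1 z * Y.indicator 1 (z + t • e - t • b) ≤ volume X * volume 𝔹 := fun t =>
    (setLIntegral_lintegral_mul_comp_le' hXm hY1 t e).trans_eq (by rw [hXi, one_mul])
  have b3 : ∀ t : ℝ, ∫⁻ b in 𝔹, ∫⁻ z,
      X.indicator 1 z * Y.indicator 1 (z + t • e - t • b) ≤ volume Y * volume 𝔹 := fun t =>
    (setLIntegral_lintegral_mul_comp_le'' hYm hX1 t e).trans_eq (by rw [hYi, one_mul])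
  have main : ∀ x y : ℝ, (∀ t : ℝ, 0 < t → ∫⁻ b in 𝔹, ∫⁻ z,
      X.indicator 1 z * Y.indicator 1 (z + t • e - t • b) ≤
      (2 : ℝ≥0∞) ^ x * min (volume 𝔹) (ENNReal.ofReal (t ^ (-(n : ℝ))) * (2 : ℝ≥0∞) ^ y)) →
      ∫⁻ t in Set.Ioi (0 : ℝ), ∫⁻ b in 𝔹, ∫⁻ z,
        X.indicator 1 z * Y.indicator 1 (z + t • e - t • b) ≤
      (volume 𝔹 + 1) * (2 : ℝ≥0∞) ^ (x + 1 / (n : ℝ) * y) := by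
    intro x y h
    calc _ ≤ ∫⁻ t in Set.Ioi (0 : ℝ), (2 : ℝ≥0∞) ^ x *
          min (volume 𝔹) (ENNReal.ofReal (t ^ (-(n : ℝ))) * (2 : ℝ≥0∞) ^ y) :=
          setLIntegral_mono (by fun_prop) h
      _ ≤ (2 : ℝ≥0∞) ^ x * ((volume 𝔹 + 1) * (2 : ℝ≥0∞) ^ (1 / (n : ℝ) * y)) := by
          rw [lintegral_const_mul _ (by fun_prop)]
          gcongr
          exact lintegral_min_rpow_le hn _ _
      _ = _ := by rw [h2]; ring
  refine ⟨main x y fun t ht => ?_, main y x fun t ht => ?_⟩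
  · rw [mul_min]
    refine le_min ((b2 t).trans ?_) ((b1 t ht).trans ?_) <;> gcongr
  · rw [mul_min]
    refine le_min ((b3 t).trans ?_) ((b1 t ht).trans ?_)
    · gcongr
    · rw [mul_left_comm (volume X), mul_left_comm ((2 : ℝ≥0∞) ^ y), mul_comm (volume X)]
      gcongr

/-- The positive trilinear form that dominates the div-curl form. -/
def averageForm (f u v : 𝔼 → ℝ≥0∞) : ℝ≥0∞ :=
  ∫⁻ b in 𝔹, ∫⁻ c in 𝔹, ∫⁻ t in Set.Ioi (0 : ℝ), ∫⁻ x, f x * u (x - t • c) * v (x - t • b)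

theorem averageForm_indicator_le (hn : 2 ≤ n) {X Y Z : Set 𝔼} (hX : MeasurableSet X)
    (hY : MeasurableSet Y) (hZ : MeasurableSet Z) {x y z : ℝ} (hx : volume X ≤ (2 : ℝ≥0∞) ^ x)
    (hy : volume Y ≤ (2 : ℝ≥0∞) ^ y) (hz : volume Z ≤ (2 : ℝ≥0∞) ^ z) :
    let C := (volume 𝔹 + 1) * volume 𝔹
    let L := averageForm (X.indicator 1) (Y.indicator 1) (Z.indicator 1)
    (L ≤ C * (2 : ℝ≥0∞) ^ (x + 1 / (n : ℝ) * y) ∧ L ≤ C * (2 : ℝ≥0∞) ^ (y + 1 / (n : ℝ) * x)) ∧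
    (L ≤ C * (2 : ℝ≥0∞) ^ (x + 1 / (n : ℝ) * z) ∧ L ≤ C * (2 : ℝ≥0∞) ^ (z + 1 / (n : ℝ) * x)) ∧
    (L ≤ C * (2 : ℝ≥0∞) ^ (y + 1 / (n : ℝ) * z) ∧ L ≤ C * (2 : ℝ≥0∞) ^ (z + 1 / (n : ℝ) * y)) := by
  intro C L
  have hX1 : ∀ z, X.indicator (1 : 𝔼 → ℝ≥0∞) z ≤ 1 := fun z =>
    Set.indicator_le_self' (fun _ _ => zero_le) z
  have hY1 : ∀ z, Y.indicator (1 : 𝔼 → ℝ≥0∞) z ≤ 1 := fun z =>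
    Set.indicator_le_self' (fun _ _ => zero_le) z
  have hZ1 : ∀ z, Z.indicator (1 : 𝔼 → ℝ≥0∞) z ≤ 1 := fun z =>
    Set.indicator_le_self' (fun _ _ => zero_le) z
  have hv : volume 𝔹 ≠ ⊤ := measure_ball_lt_top.ne
  have step : ∀ {G : 𝔼 → ℝ≥0∞} {K : ℝ}, (∀ b, G b ≤ (volume 𝔹 + 1) * (2 : ℝ≥0∞) ^ K) →
      ∫⁻ b in 𝔹, G b ≤ C * (2 : ℝ≥0∞) ^ K := by
    intro G K hG
    calc _ ≤ ∫⁻ b in 𝔹, (volume 𝔹 + 1) * (2 : ℝ≥0∞) ^ K := lintegral_mono fun b => hG b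
      _ = _ := by rw [setLIntegral_const]; simp only [C]; ring
  refine ⟨?_, ?_, ?_⟩
  · have h := setLIntegral_pair_le hn hX hY hx hy 0
    have hle : ∀ b : 𝔼, ∫⁻ c in 𝔹, ∫⁻ t in Set.Ioi (0 : ℝ), ∫⁻ x,
        X.indicator 1 x * Y.indicator 1 (x - t • c) * Z.indicator 1 (x - t • b)
        ≤ ∫⁻ c in 𝔹, ∫⁻ t in Set.Ioi (0 : ℝ), ∫⁻ x,
        X.indicator 1 x * Y.indicator 1 (x + t • (0 : 𝔼) - t • c) := by
      intro b
      refine lintegral_mono fun c => lintegral_mono fun t => lintegral_mono fun x => ?_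
      simp only [smul_zero, add_zero]
      exact mul_le_of_le_one_right' (hZ1 _)
    exact ⟨step fun b => (hle b).trans h.1, step fun b => (hle b).trans h.2⟩
  · have h := setLIntegral_pair_le hn hX hZ hx hz 0
    have hle : L ≤ (∫⁻ b in 𝔹, ∫⁻ t in Set.Ioi (0 : ℝ), ∫⁻ x,
        X.indicator 1 x * Z.indicator 1 (x + t • (0 : 𝔼) - t • b)) * volume 𝔹 := by
      rw [← lintegral_mul_const' _ _ hv]
      simp_rw [← setLIntegral_const]
      simp only [L, averageForm]
      refine lintegral_mono fun b => lintegral_mono fun c => lintegral_mono fun t =>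
        lintegral_mono fun x => ?_
      simp only [smul_zero, add_zero]
      rw [mul_right_comm]
      exact mul_le_of_le_one_right' (hY1 _)
    constructor
    · refine hle.trans ((mul_le_mul_left h.1 _).trans_eq ?_)
      simp only [C]; ring
    · refine hle.trans ((mul_le_mul_left h.2 _).trans_eq ?_)
      simp only [C]; ring
  · have h := fun b => setLIntegral_pair_le hn hZ hY hz hy b
    have hle : ∀ b : 𝔼, ∫⁻ c in 𝔹, ∫⁻ t in Set.Ioi (0 : ℝ), ∫⁻ x,
        X.indicator 1 x * Y.indicator 1 (x - t • c) * Z.indicator 1 (x - t • b)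
        ≤ ∫⁻ c in 𝔹, ∫⁻ t in Set.Ioi (0 : ℝ), ∫⁻ x,
        Z.indicator 1 x * Y.indicator 1 (x + t • b - t • c) := by
      intro b
      refine lintegral_mono fun c => lintegral_mono fun t => ?_
      dsimp only
      rw [← lintegral_sub_right_eq_self (fun x => Z.indicator 1 x *
        Y.indicator (1 : 𝔼 → ℝ≥0∞) (x + t • b - t • c)) (t • b)]
      refine lintegral_mono fun x => ?_
      rw [mul_comm (Z.indicator _ _), sub_add_cancel]
      gcongr
      exact mul_le_of_le_one_left' (hX1 _)
    exact ⟨step fun b => (hle b).trans (h b).2, step fun b => (hle b).trans (h b).1⟩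

theorem averageForm_eq_lintegral_prod {f u v : 𝔼 → ℝ≥0∞} (hf : Measurable f) (hu : Measurable u)
    (hv : Measurable v) :
    averageForm f u v = ∫⁻ z : 𝔼 × 𝔼 × ℝ × 𝔼,
      f z.2.2.2 * u (z.2.2.2 - z.2.2.1 • z.2.1) * v (z.2.2.2 - z.2.2.1 • z.1)
      ∂((volume.restrict 𝔹).prod ((volume.restrict 𝔹).prod
        ((volume.restrict (Set.Ioi (0 : ℝ))).prod volume))) := by
  rw [lintegral_prod _ (by fun_prop)]
  simp only [averageForm]
  congr 1
  ext b
  rw [lintegral_prod _ (by fun_prop)]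
  congr 1
  ext c
  rw [lintegral_prod _ (by fun_prop)]

theorem averageForm_le_tsum {f u v : 𝔼 → ℝ≥0∞} {r s w : ℤ → ℝ≥0∞} {E G H : ℤ → Set 𝔼}
    (hE : ∀ i, MeasurableSet (E i)) (hG : ∀ i, MeasurableSet (G i))
    (hH : ∀ i, MeasurableSet (H i)) (hf : ∀ x, f x ≤ ∑' i, r i * (E i).indicator 1 x)
    (hu : ∀ x, u x ≤ ∑' i, s i * (G i).indicator 1 x)
    (hv : ∀ x, v x ≤ ∑' i, w i * (H i).indicator 1 x) :
    averageForm f u v ≤ ∑' i, ∑' j, ∑' l, r i * s j * w l *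
      averageForm ((E i).indicator 1) ((G j).indicator 1) ((H l).indicator 1) := by
  have hEm := fun i => (measurable_one : Measurable (1 : 𝔼 → ℝ≥0∞)).indicator (hE i)
  have hGm := fun i => (measurable_one : Measurable (1 : 𝔼 → ℝ≥0∞)).indicator (hG i)
  have hHm := fun i => (measurable_one : Measurable (1 : 𝔼 → ℝ≥0∞)).indicator (hH i)
  have hmeas : ∀ i j l, Measurable fun z : 𝔼 × 𝔼 × ℝ × 𝔼 => (E i).indicator (1 : 𝔼 → ℝ≥0∞) z.2.2.2 *
      (G j).indicator (1 : 𝔼 → ℝ≥0∞) (z.2.2.2 - z.2.2.1 • z.2.1) *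
      (H l).indicator (1 : 𝔼 → ℝ≥0∞) (z.2.2.2 - z.2.2.1 • z.1) := fun i j l =>
    (((hEm i).comp (by fun_prop)).mul ((hGm j).comp (by fun_prop))).mul
      ((hHm l).comp (by fun_prop))
  calc averageForm f u v
      ≤ averageForm (fun x => ∑' i, r i * (E i).indicator 1 x)
        (fun x => ∑' i, s i * (G i).indicator 1 x) (fun x => ∑' i, w i * (H i).indicator 1 x) := by
        simp only [averageForm]
        refine lintegral_mono fun b => lintegral_mono fun c => lintegral_mono fun t =>
          lintegral_mono fun x => ?_
        exact mul_le_mul' (mul_le_mul' (hf _) (hu _)) (hv _)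
    _ = ∑' i, ∑' j, ∑' l, r i * s j * w l *
      averageForm ((E i).indicator 1) ((G j).indicator 1) ((H l).indicator 1) := by
        rw [averageForm_eq_lintegral_prod (Measurable.tsum fun i => (hEm i).const_mul _)
          (Measurable.tsum fun i => (hGm i).const_mul _)
          (Measurable.tsum fun i => (hHm i).const_mul _)]
        simp_rw [averageForm_eq_lintegral_prod (hEm _) (hGm _) (hHm _)]
        have e : ∀ (a b c : ℤ → ℝ≥0∞), (∑' i, r i * a i) * (∑' i, s i * b i) * (∑' i, w i * c i)
            = ∑' i, ∑' j, ∑' l, r i * s j * w l * (a i * b j * c l) := by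
          intro a b c
          rw [mul_assoc, ← ENNReal.tsum_mul_right]
          congr! 2 with i
          rw [← ENNReal.tsum_mul_right, ← ENNReal.tsum_mul_left]
          congr! 2 with j
          rw [← ENNReal.tsum_mul_left, ← ENNReal.tsum_mul_left]
          congr! 2 with l
          ring
        simp_rw [e]
        rw [lintegral_tsum fun i => (Measurable.tsum fun j =>
          Measurable.tsum fun l => (hmeas i j l).const_mul _).aemeasurable]
        congr! 2 with i
        rw [lintegral_tsum fun j => (Measurable.tsum fun l =>
          (hmeas i j l).const_mul _).aemeasurable]
        congr! 2 with j
        rw [lintegral_tsum fun l => ((hmeas i j l).const_mul _).aemeasurable]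
        congr! 2 with l
        rw [lintegral_const_mul _ (hmeas i j l)]

/-- Lorentz-space bound for the positive trilinear form. -/
theorem exists_averageForm_le_lorentzNorm (hn : 2 ≤ n) {p : ℝ} (hp : 1 < p)
    {q₁ q₂ q₃ : ℝ≥0∞} (hq₁ : 1 ≤ q₁) (hq₂ : 1 ≤ q₂) (hq₃ : 1 ≤ q₃)
    (hq : 1 / q₁ + 1 / q₂ + 1 / q₃ = 1) :
    ∃ C : ℝ≥0∞, C ≠ ⊤ ∧ ∀ f u v : 𝔼 → ℝ, Continuous f → Continuous u → Continuous v →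
      lorentzNorm volume p q₁ f ≠ 0 → lorentzNorm volume p q₁ f ≠ ⊤ →
      lorentzNorm volume (n : ℝ) q₃ u ≠ 0 → lorentzNorm volume (n : ℝ) q₃ u ≠ ⊤ →
      lorentzNorm volume (p / (p - 1)) q₂ v ≠ 0 → lorentzNorm volume (p / (p - 1)) q₂ v ≠ ⊤ →
      averageForm (fun x => ENNReal.ofReal |f x|) (fun x => ENNReal.ofReal |u x|)
        (fun x => ENNReal.ofReal |v x|) ≤ C * lorentzNorm volume p q₁ f *
          lorentzNorm volume (p / (p - 1)) q₂ v * lorentzNorm volume (n : ℝ) q₃ u := by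
  have hn' : (2 : ℝ) ≤ n := by exact_mod_cast hn
  have hn0 : (0 : ℝ) < n := by linarith
  have hp0 : 0 < p := by linarith
  have hp1 : 0 < p - 1 := by linarith
  have hp' : 1 ≤ p / (p - 1) := by rw [le_div_iff₀ hp1]; linarith
  obtain ⟨C₁, hC₁, H₁⟩ := exists_lorentz_decomposition (volume : Measure 𝔼) hp.le hq₁
  obtain ⟨C₂, hC₂, H₂⟩ := exists_lorentz_decomposition (volume : Measure 𝔼) hp' hq₂
  obtain ⟨C₃, hC₃, H₃⟩ := exists_lorentz_decomposition (volume : Measure 𝔼)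
    (by linarith : (1 : ℝ) ≤ n) hq₃
  have hps : 1 / p + 1 / (p / (p - 1)) = 1 := by field_simp; ring
  have hpp : 0 < 1 / p := by positivity
  have hpp' : 0 < 1 / (p / (p - 1)) := by positivity
  obtain ⟨ε, hε, hker⟩ := le_two_rpow_of_pair_bounds (α := 1 / p) (β := 1 / (n : ℝ))
    (γ := 1 / (p / (p - 1))) (κ := 1 / (n : ℝ)) hpp (by positivity) hpp'
    (by linarith) (by rw [div_lt_one hn0]; linarith) (by linarith) (by linarith)
  have hqs : (1 / q₁).toReal + (1 / q₃).toReal + (1 / q₂).toReal = 1 := by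
    have hne : 1 / q₁ + 1 / q₂ + 1 / q₃ ≠ ⊤ := by rw [hq]; simp
    simp only [ne_eq, ENNReal.add_eq_top, not_or] at hne
    rw [← ENNReal.toReal_add hne.1.1 hne.2, ← ENNReal.toReal_add _ hne.1.2, add_right_comm, hq,
      ENNReal.toReal_one]
    exact ENNReal.add_ne_top.2 ⟨hne.1.1, hne.2⟩
  have hv : volume 𝔹 ≠ ⊤ := measure_ball_lt_top.ne
  set S := ∑' m : ℤ, (2 : ℝ≥0∞) ^ (-(ε * |(m : ℝ)|)) with hS
  have hSt : S ≠ ⊤ := tsum_two_rpow_neg_abs_ne_top hε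
  refine ⟨(volume 𝔹 + 1) * volume 𝔹 * C₁ * C₃ * C₂ * (3 * S ^ 2), by finiteness,
    fun f u v hf hu hv' hf0 hft hu0 hut hv0 hvt => ?_⟩
  obtain ⟨r, E, a, hE, hEv, hfr, hra, ha⟩ := H₁ f hf hf0 hft
  obtain ⟨w, H, c, hH, hHv, hvw, hwc, hc⟩ := H₂ v hv' hv0 hvt
  obtain ⟨s, G, b, hG, hGv, hus, hsb, hb⟩ := H₃ u hu hu0 hut
  refine (averageForm_le_tsum hE hG hH hfr hus hvw).trans ?_
  have hx : ∀ i : ℤ, r i ≤ C₁ * lorentzNorm volume p q₁ f * (2 : ℝ≥0∞) ^ (-(1 / p * i)) *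
      a i ^ (1 / q₁).toReal := fun i => (hra i).trans_eq (by rw [one_div_mul_eq_div])
  have hy : ∀ i : ℤ, s i ≤ C₃ * lorentzNorm volume (n : ℝ) q₃ u *
      (2 : ℝ≥0∞) ^ (-(1 / (n : ℝ) * i)) * b i ^ (1 / q₃).toReal :=
    fun i => (hsb i).trans_eq (by rw [one_div_mul_eq_div])
  have hz : ∀ i : ℤ, w i ≤ C₂ * lorentzNorm volume (p / (p - 1)) q₂ v *
      (2 : ℝ≥0∞) ^ (-(1 / (p / (p - 1)) * i)) * c i ^ (1 / q₂).toReal :=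
    fun i => (hwc i).trans_eq (by rw [one_div_mul_eq_div])
  refine (tsum_trilinear_le ENNReal.toReal_nonneg ENNReal.toReal_nonneg ENNReal.toReal_nonneg hqs
    hx hy hz ha hb hc (C := (volume 𝔹 + 1) * volume 𝔹) (ε := ε) fun i j l => ?_).trans_eq ?_
  · obtain ⟨⟨h1, h2⟩, ⟨h3, h4⟩, h5, h6⟩ := averageForm_indicator_le hn (hE i) (hG j) (hH l)
      (hEv i) (hGv j) (hHv l)
    exact hker _ _ _ _ _ h1 h2 h3 h4 h5 h6
  · ring

/-- Decay of the averages of a trilinear form at large scales. -/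
theorem exists_scaled_average_le {p : ℝ} (hp : 1 < p) {q : ℝ≥0∞} (hq : 1 ≤ q) {f : 𝔼 → ℝ}
    (hf : Continuous f) (hf0 : lorentzNorm volume p q f ≠ 0) (hft : lorentzNorm volume p q f ≠ ⊤)
    {u v : 𝔼 → ℝ≥0∞} (hu : Measurable u) (hv : Measurable v) {M : ℝ≥0∞} (hM : M ≠ ⊤)
    (huM : ∀ x, u x ≤ M) (hui : ∫⁻ x, u x ≠ ⊤) (hvi : ∫⁻ x, v x ≠ ⊤) :
    ∃ K : ℝ≥0∞, K ≠ ⊤ ∧ ∀ t : ℝ, 0 < t →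
      ∫⁻ b in 𝔹, ∫⁻ c in 𝔹, ∫⁻ x, ENNReal.ofReal |f x| * u (x - t • c) * v (x - t • b)
        ≤ ENNReal.ofReal (t ^ (-(n : ℝ))) * K := by
  have hp0 : 0 < p := by linarith
  obtain ⟨C, hC, H⟩ := exists_lorentz_decomposition (volume : Measure 𝔼) hp.le hq
  obtain ⟨r, E, a, hE, hEv, hfr, hra, ha⟩ := H f hf hf0 hft
  have hB : volume 𝔹 ≠ ⊤ := measure_ball_lt_top.ne
  have hEm := fun i => (measurable_one : Measurable (1 : 𝔼 → ℝ≥0∞)).indicator (hE i)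
  have hE1 : ∀ i z, (E i).indicator (1 : 𝔼 → ℝ≥0∞) z ≤ 1 := fun i z =>
    Set.indicator_le_self' (fun _ _ => zero_le) z
  set N := C * lorentzNorm volume p q f with hN
  have hNt : N ≠ ⊤ := ENNReal.mul_ne_top hC hft
  set δ := min (1 / p) (1 - 1 / p) with hδ
  have hδ0 : 0 < δ := lt_min (by positivity) (by rw [sub_pos, div_lt_one hp0]; exact hp)
  set S := ∑' m : ℤ, (2 : ℝ≥0∞) ^ (-(δ * |(m : ℝ)|)) with hS
  have hSt : S ≠ ⊤ := tsum_two_rpow_neg_abs_ne_top hδ0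
  set A := volume 𝔹 * ((∫⁻ x, u x) + M) * ∫⁻ x, v x with hA
  have hAt : A ≠ ⊤ := by finiteness
  refine ⟨N * A * S, by finiteness, fun t ht => ?_⟩
  set τ := ENNReal.ofReal (t ^ (-(n : ℝ))) with hτ
  have hmeas : ∀ i, Measurable fun z : 𝔼 × 𝔼 × 𝔼 => (E i).indicator (1 : 𝔼 → ℝ≥0∞) z.2.2 *
      u (z.2.2 - t • z.2.1) * v (z.2.2 - t • z.1) := fun i =>
    (((hEm i).comp (by fun_prop)).mul (hu.comp (by fun_prop))).mul (hv.comp (by fun_prop))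
  have hone : ∀ i, ∫⁻ b in 𝔹, ∫⁻ c in 𝔹, ∫⁻ x, (E i).indicator 1 x * u (x - t • c) * v (x - t • b)
      ≤ τ * A * min 1 ((2 : ℝ≥0∞) ^ (i : ℝ)) := by
    intro i
    rw [mul_min, mul_one]
    refine le_min ?_ ?_
    · calc _ ≤ ∫⁻ b in 𝔹, (∫⁻ y, v y) * (τ * ∫⁻ y, u y) := by
            refine lintegral_mono fun b => ?_
            refine le_trans ?_ (setLIntegral_lintegral_mul_comp_le hv hu ht b)
            refine lintegral_mono fun c => ?_
            dsimp only
            rw [← lintegral_sub_right_eq_self (fun x => v x * u (x + t • b - t • c)) (t • b)]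
            refine lintegral_mono fun x => ?_
            rw [mul_comm (v _), sub_add_cancel]
            gcongr
            exact mul_le_of_le_one_left' (hE1 i _)
        _ = τ * (volume 𝔹 * (∫⁻ y, u y) * (∫⁻ y, v y)) := by rw [setLIntegral_const]; ring
        _ ≤ _ := by
            rw [hA]
            gcongr
            exact le_self_add
    · have hX : ∫⁻ z, (E i).indicator (1 : 𝔼 → ℝ≥0∞) z = volume (E i) :=
        lintegral_indicator_one (hE i)
      calc _ ≤ ∫⁻ b in 𝔹, (∫⁻ x, (E i).indicator 1 x * v (x + t • (0 : 𝔼) - t • b)) *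
              (M * volume 𝔹) := by
            refine lintegral_mono fun b => ?_
            dsimp only
            rw [← mul_assoc, ← setLIntegral_const]
            refine lintegral_mono fun c => ?_
            dsimp only
            rw [← lintegral_mul_const' _ _ hM]
            refine lintegral_mono fun x => ?_
            rw [mul_right_comm, smul_zero, add_zero]
            gcongr
            exact huM _
        _ ≤ (volume (E i)) * (τ * ∫⁻ y, v y) * (M * volume 𝔹) := by
            rw [lintegral_mul_const' _ _ (by finiteness)]
            gcongr
            exact (setLIntegral_lintegral_mul_comp_le (hEm i) hv ht 0).trans_eq (by rw [hX])
        _ = τ * (volume 𝔹 * M * ∫⁻ y, v y) * volume (E i) := by ring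
        _ ≤ _ := by
            rw [hA]
            gcongr
            · exact le_add_self
            · exact hEv i
  have hr : ∀ i : ℤ, r i * min 1 ((2 : ℝ≥0∞) ^ (i : ℝ)) ≤
      N * (2 : ℝ≥0∞) ^ (-(δ * |(i : ℝ)|)) := by
    intro i
    have ha1 : a i ^ (1 / q).toReal ≤ 1 :=
      ENNReal.rpow_le_one ((ENNReal.le_tsum i).trans ha) ENNReal.toReal_nonneg
    have h1 : r i ≤ N * (2 : ℝ≥0∞) ^ (-((i : ℝ) / p)) :=
      (hra i).trans (mul_le_of_le_one_right' ha1)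
    have hδ1 : δ ≤ 1 / p := min_le_left _ _
    have hδ2 : δ ≤ 1 - 1 / p := min_le_right _ _
    have hdiv : (i : ℝ) / p = 1 / p * i := by ring
    calc r i * min 1 ((2 : ℝ≥0∞) ^ (i : ℝ)) ≤ N * ((2 : ℝ≥0∞) ^ (-((i : ℝ) / p)) *
          min 1 ((2 : ℝ≥0∞) ^ (i : ℝ))) := by rw [← mul_assoc]; gcongr
      _ ≤ _ := by
        gcongr
        rcases le_total 0 (i : ℝ) with h | h
        · refine (mul_le_mul_right (min_le_left _ _) _).trans ?_
          rw [mul_one, abs_of_nonneg h]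
          apply ENNReal.rpow_le_rpow_of_exponent_le (by norm_num)
          rw [hdiv]
          nlinarith
        · refine (mul_le_mul_right (min_le_right _ _) _).trans ?_
          rw [abs_of_nonpos h, ← ENNReal.rpow_add _ _ two_ne_zero ENNReal.ofNat_ne_top]
          apply ENNReal.rpow_le_rpow_of_exponent_le (by norm_num)
          rw [hdiv]
          nlinarith
  calc _ ≤ ∫⁻ b in 𝔹, ∫⁻ c in 𝔹, ∫⁻ x, ∑' i, r i * ((E i).indicator 1 x *
          u (x - t • c) * v (x - t • b)) := by
        refine lintegral_mono fun b => lintegral_mono fun c => lintegral_mono fun x => ?_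
        simp_rw [← mul_assoc]
        rw [ENNReal.tsum_mul_right, ENNReal.tsum_mul_right]
        exact mul_le_mul' (mul_le_mul' (hfr x) le_rfl) le_rfl
    _ = ∫⁻ z : 𝔼 × 𝔼 × 𝔼, ∑' i, r i * ((E i).indicator 1 z.2.2 *
          u (z.2.2 - t • z.2.1) * v (z.2.2 - t • z.1))
          ∂((volume.restrict 𝔹).prod ((volume.restrict 𝔹).prod volume)) := by
        rw [lintegral_prod _ (Measurable.tsum fun i => (hmeas i).const_mul _).aemeasurable]
        congr 1
        ext b
        rw [lintegral_prod]
        exact ((Measurable.tsum fun i => (hmeas i).const_mul (r i)).comp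
          (measurable_prodMk_left (x := b))).aemeasurable
    _ = ∑' i, r i * ∫⁻ b in 𝔹, ∫⁻ c in 𝔹, ∫⁻ x, (E i).indicator 1 x *
          u (x - t • c) * v (x - t • b) := by
        rw [lintegral_tsum fun i => ((hmeas i).const_mul _).aemeasurable]
        congr 1
        ext i
        rw [lintegral_const_mul _ (hmeas i), lintegral_prod _ (hmeas i).aemeasurable]
        congr 2
        ext b
        rw [lintegral_prod]
        exact ((hmeas i).comp (measurable_prodMk_left (x := b))).aemeasurable
    _ ≤ ∑' i, r i * (τ * A * min 1 ((2 : ℝ≥0∞) ^ (i : ℝ))) := by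
        refine ENNReal.tsum_le_tsum fun i => ?_
        gcongr
        exact hone i
    _ ≤ ∑' i : ℤ, τ * A * (N * (2 : ℝ≥0∞) ^ (-(δ * |(i : ℝ)|))) := by
        refine ENNReal.tsum_le_tsum fun i => ?_
        rw [mul_left_comm]
        exact mul_le_mul_right (hr i) _
    _ = _ := by rw [ENNReal.tsum_mul_left, ENNReal.tsum_mul_left]; ring

theorem volume_ball_mul_enorm_integral_le {p : ℝ} (hp : 1 < p) {q : ℝ≥0∞} (hq : 1 ≤ q)
    (hn : n ≠ 0) {F : 𝔼 → 𝔼} (hF : ContDiff ℝ 1 F)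
    (hdiv : ∀ x, ∑ a, fderiv ℝ F x (EuclideanSpace.single a 1) a = 0)
    (hF0 : lorentzNorm volume p q (fun x => ‖F x‖) ≠ 0)
    (hFt : lorentzNorm volume p q (fun x => ‖F x‖) ≠ ⊤)
    {g h : 𝔼 → ℝ} (hg : ContDiff ℝ 2 g) (hgc : HasCompactSupport g)
    (hh : ContDiff ℝ 2 h) (hhc : HasCompactSupport h) :
    volume 𝔹 * volume 𝔹 * ‖∫ x, fderiv ℝ g x (F x) * h x‖ₑ ≤
      2 * averageForm (fun x => ‖F x‖ₑ) (fun x => ‖fderiv ℝ g x‖ₑ) (fun x => ‖fderiv ℝ h x‖ₑ) := by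
  have hFc := hF.continuous
  have hhC := hh.continuous
  have hg1 := hg.continuous_fderiv two_ne_zero
  obtain ⟨M, hM⟩ := (hgc.fderiv (𝕜 := ℝ)).exists_bound_of_continuous hg1
  obtain ⟨K, hK, H⟩ := exists_scaled_average_le hp hq hFc.norm hF0 hFt
    (u := fun x => ‖fderiv ℝ g x‖ₑ) (v := fun x => ‖h x‖ₑ) hg1.enorm.measurable
    hhC.enorm.measurable (M := ENNReal.ofReal M) ENNReal.ofReal_ne_top
    (fun x => by rw [← ofReal_norm]; exact ENNReal.ofReal_le_ofReal (hM x))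
    (hg1.integrable_of_hasCompactSupport (hgc.fderiv (𝕜 := ℝ))).hasFiniteIntegral.ne
    (hhC.integrable_of_hasCompactSupport hhc).hasFiniteIntegral.ne
  simp_rw [abs_norm, ofReal_norm] at H
  set Y := averageForm (fun x => ‖F x‖ₑ) (fun x => ‖fderiv ℝ g x‖ₑ) (fun x => ‖fderiv ℝ h x‖ₑ)
    with hY
  have key : ∀ T : ℝ, 0 < T → volume 𝔹 * volume 𝔹 * ‖∫ x, fderiv ℝ g x (F x) * h x‖ₑ ≤
      ENNReal.ofReal (T ^ (-(n : ℝ))) * K + 2 * Y := by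
    intro T hT
    have hm : Measurable fun z : (𝔼 × 𝔼) × 𝔼 =>
        ‖F z.2‖ₑ * ‖fderiv ℝ g (z.2 - T • z.1.2)‖ₑ * ‖h (z.2 - T • z.1.1)‖ₑ := by
      have c1 : Continuous fun z : (𝔼 × 𝔼) × 𝔼 => ‖F z.2‖ₑ := by fun_prop
      have c2 : Continuous fun z : (𝔼 × 𝔼) × 𝔼 => ‖fderiv ℝ g (z.2 - T • z.1.2)‖ₑ := by fun_prop
      have c3 : Continuous fun z : (𝔼 × 𝔼) × 𝔼 => ‖h (z.2 - T • z.1.1)‖ₑ := by fun_prop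
      exact (c1.measurable.mul c2.measurable).mul c3.measurable
    have hm2 := hm.lintegral_prod_right' (ν := (volume : Measure 𝔼))
    have hm3 := hm2.lintegral_prod_right' (ν := (volume : Measure 𝔼).restrict 𝔹)
    calc volume 𝔹 * volume 𝔹 * ‖∫ x, fderiv ℝ g x (F x) * h x‖ₑ
        = ∫⁻ _ in 𝔹, ∫⁻ _ in 𝔹, ‖∫ x, fderiv ℝ g x (F x) * h x‖ₑ := by
          rw [setLIntegral_const, setLIntegral_const]; ring
      _ ≤ ∫⁻ b in 𝔹, ∫⁻ c in 𝔹,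
          ((∫⁻ x, ‖F x‖ₑ * ‖fderiv ℝ g (x - T • c)‖ₑ * ‖h (x - T • b)‖ₑ) +
          2 * ∫⁻ t in Set.Ioi (0 : ℝ), ∫⁻ x,
            ‖F x‖ₑ * ‖fderiv ℝ g (x - t • c)‖ₑ * ‖fderiv ℝ h (x - t • b)‖ₑ) := by
          refine setLIntegral_mono' measurableSet_ball fun b hb =>
            setLIntegral_mono' measurableSet_ball fun c hc => ?_
          refine (enorm_integral_fderiv_mul_le hF hdiv hg hh hhc
            (mem_ball_zero_iff.1 hb).le (mem_ball_zero_iff.1 hc).le hT.le).trans ?_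
          refine add_le_add ?_ (le_of_eq ?_)
          · refine (enorm_integral_le_lintegral_enorm _).trans (lintegral_mono fun x => ?_)
            rw [enorm_mul, mul_comm ‖F x‖ₑ]
            exact mul_le_mul' (ContinuousLinearMap.le_opENorm _ _) le_rfl
          · simp_rw [lintegral_const_mul' _ _ ENNReal.ofNat_ne_top]
      _ = (∫⁻ b in 𝔹, ∫⁻ c in 𝔹, ∫⁻ x,
            ‖F x‖ₑ * ‖fderiv ℝ g (x - T • c)‖ₑ * ‖h (x - T • b)‖ₑ) + 2 * Y := by
          rw [hY, averageForm, ← lintegral_const_mul' _ _ ENNReal.ofNat_ne_top,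
            ← lintegral_add_left hm3]
          refine lintegral_congr fun b => ?_
          rw [← lintegral_const_mul' _ _ ENNReal.ofNat_ne_top]
          exact lintegral_add_left (hm2.comp (measurable_prodMk_left (x := b))) _
      _ ≤ _ := add_le_add (H T hT) le_rfl
  have hlim : Filter.Tendsto (fun T : ℝ => ENNReal.ofReal (T ^ (-(n : ℝ))) * K + 2 * Y)
      Filter.atTop (nhds (ENNReal.ofReal 0 * K + 2 * Y)) :=
    (ENNReal.Tendsto.mul_const (ENNReal.tendsto_ofReal (tendsto_rpow_neg_atTop (by positivity)))
      (Or.inr hK)).add_const _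
  rw [ENNReal.ofReal_zero, zero_mul, zero_add] at hlim
  exact ge_of_tendsto hlim ((Filter.eventually_gt_atTop 0).mono key)

end Averages

/-- Lorentz-space div-curl estimate. For `p ∈ (1,∞)`, `p' = p/(p-1)`,
and `q₁, q₂, q₃ ∈ [1,∞]` with `1/q₁ + 1/q₂ + 1/q₃ = 1`, there is `C = C(n,p,q₁,q₂,q₃)`
such that for every smooth divergence-free vector field `F : ℝ^n → ℝ^n` and all
`g, h ∈ C_c^∞(ℝ^n)`,
`|∫ (F · ∇g) h| ≤ C ‖F‖_{L^{p,q₁}} ‖∇h‖_{L^{p',q₂}} ‖∇g‖_{L^{n,q₃}}`. -/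
theorem lorentz_div_curl_estimate
    (n : ℕ) (hn : 2 ≤ n) (p : ℝ) (hp : 1 < p)
    (q₁ q₂ q₃ : ℝ≥0∞) (hq₁ : 1 ≤ q₁) (hq₂ : 1 ≤ q₂) (hq₃ : 1 ≤ q₃)
    (hq : 1 / q₁ + 1 / q₂ + 1 / q₃ = 1) :
    ∃ C : ℝ, 0 < C ∧
      ∀ (F : EuclideanSpace ℝ (Fin n) → EuclideanSpace ℝ (Fin n))
        (g h : EuclideanSpace ℝ (Fin n) → ℝ),
        ContDiff ℝ (⊤ : ℕ∞) F →
        -- `div F = 0`: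
        (∀ x, ∑ a, fderiv ℝ F x (EuclideanSpace.single a 1) a = 0) →
        ContDiff ℝ (⊤ : ℕ∞) g → HasCompactSupport g →
        ContDiff ℝ (⊤ : ℕ∞) h → HasCompactSupport h →
        ENNReal.ofReal
            |∫ x, (∑ a, F x a * fderiv ℝ g x (EuclideanSpace.single a 1)) * h x|
          ≤ ENNReal.ofReal C *
              lorentzNorm volume p q₁ (fun x => ‖F x‖) *
              lorentzNorm volume (p / (p - 1)) q₂ (fun x => ‖fderiv ℝ h x‖) *
              lorentzNorm volume (n : ℝ) q₃ (fun x => ‖fderiv ℝ g x‖) := by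
  have hp0 : 0 < p := by linarith
  have hpp : 0 < p / (p - 1) := div_pos hp0 (by linarith)
  have hn0 : (0 : ℝ) < n := by exact_mod_cast (by omega : 0 < n)
  obtain ⟨C, hC, H⟩ := exists_averageForm_le_lorentzNorm hn hp hq₁ hq₂ hq₃ hq
  set V := volume (ball (0 : EuclideanSpace ℝ (Fin n)) 1) with hV
  have hV0 : V ≠ 0 := (measure_ball_pos _ _ one_pos).ne'
  have hVt : V ≠ ⊤ := measure_ball_lt_top.ne
  have hVV : V * V ≠ 0 := mul_ne_zero hV0 hV0
  set D := 2 * C / (V * V) with hD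
  have hDt : D ≠ ⊤ := ENNReal.div_ne_top (by finiteness) hVV
  refine ⟨D.toReal + 1, by positivity, fun F g h hF hdiv hg hgc hh hhc => ?_⟩
  have hF1 : ContDiff ℝ 1 F := hF.of_le (by exact_mod_cast le_top)
  have hg2 : ContDiff ℝ 2 g := contDiff_infty.1 hg 2
  have hh2 : ContDiff ℝ 2 h := contDiff_infty.1 hh 2
  have hFc := hF.continuous
  have hg1 := hg2.continuous_fderiv two_ne_zero
  have hh1 := hh2.continuous_fderiv two_ne_zero
  simp_rw [sum_mul_apply_single, ← Real.enorm_eq_ofReal_abs]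
  set NF := lorentzNorm volume p q₁ (fun x => ‖F x‖) with hNF
  set Nh := lorentzNorm volume (p / (p - 1)) q₂ (fun x => ‖fderiv ℝ h x‖) with hNh
  set Ng := lorentzNorm volume (n : ℝ) q₃ (fun x => ‖fderiv ℝ g x‖) with hNg
  by_cases hF0 : NF = 0
  · have := eq_zero_of_lorentzNorm_eq_zero hp0 hq₁ hFc.norm hF0
    simp [norm_eq_zero.1 (this _)]
  by_cases hg0 : Ng = 0
  · have := eq_zero_of_lorentzNorm_eq_zero hn0 hq₃ hg1.norm hg0
    simp [norm_eq_zero.1 (this _)]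
  by_cases hh0 : Nh = 0
  · have := eq_zero_of_lorentzNorm_eq_zero hpp hq₂ hh1.norm hh0
    rw [integral_fderiv_apply_mul hF1 hdiv (hg2.of_le (by norm_num)) (hh2.of_le (by norm_num)) hhc]
    simp [norm_eq_zero.1 (this _)]
  have hC0 : ENNReal.ofReal (D.toReal + 1) ≠ 0 := by
    rw [Ne, ENNReal.ofReal_eq_zero, not_le]; positivity
  by_cases hFt : NF = ⊤
  · rw [hFt, ENNReal.mul_top hC0, ENNReal.top_mul hh0, ENNReal.top_mul hg0]; exact le_top
  by_cases hht : Nh = ⊤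
  · rw [hht, ENNReal.mul_top (mul_ne_zero hC0 hF0), ENNReal.top_mul hg0]; exact le_top
  by_cases hgt : Ng = ⊤
  · rw [hgt, ENNReal.mul_top (mul_ne_zero (mul_ne_zero hC0 hF0) hh0)]; exact le_top
  have h1 := volume_ball_mul_enorm_integral_le hp hq₁ (by omega) hF1 hdiv hF0 hFt hg2 hgc hh2 hhc
  have h2 := H _ _ _ hFc.norm hg1.norm hh1.norm hF0 hFt hg0 hgt hh0 hht
  simp_rw [abs_norm, ofReal_norm] at h2
  have h3 : V * V * ‖∫ x, fderiv ℝ g x (F x) * h x‖ₑ ≤ 2 * C * (NF * Nh * Ng) :=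
    h1.trans ((mul_le_mul_right h2 2).trans_eq (by ring))
  calc ‖∫ x, fderiv ℝ g x (F x) * h x‖ₑ
      ≤ 2 * C * (NF * Nh * Ng) / (V * V) := by
        rw [ENNReal.le_div_iff_mul_le (Or.inl hVV) (Or.inl (by finiteness)), mul_comm]
        exact h3
    _ = D * NF * Nh * Ng := by rw [hD, ENNReal.div_eq_inv_mul, ENNReal.div_eq_inv_mul]; ring
    _ ≤ ENNReal.ofReal (D.toReal + 1) * NF * Nh * Ng := by
        gcongr
        exact ENNReal.le_ofReal_iff_toReal_le hDt (by positivity) |>.2 (by linarith)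
end
end
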